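/- arXiv:math/0403089 — 2 statements merged into one kernel-verified Lean document; each statement's English description precedes it below -/
import Mathlib

section
/- Every knot can be represented by a C² curve of constant curvature: for every C¹ embedding γ : 𝕊¹ → ℝ³ with nowhere-vanishing derivative, there exist L > 0, a C² map r : ℝ → ℝ³ with r(s + L) = r(s) for all s, ‖r'(s)‖ = 1 and ‖r''(s)‖ = 1 for all s ∈ ℝ, r injective on [0, L), and a continuous map H : ℝ³ × [0,1] → ℝ³ such that H(·, 0) is the identity of ℝ³, H(·, t) is a homeomorphism of ℝ³ for every t ∈ [0,1], and H(γ(𝕊¹) × {1}) equals the image r(ℝ). -/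
open Set Metric Real

noncomputable section

/-- Points of `ℝ³` with the Euclidean norm. -/
abbrev E3 := EuclideanSpace ℝ (Fin 3)

/-- `T` is a `C¹` curve on the unit sphere, parametrised by arc length, with velocity `N`. -/
structure IsUnitSpeedSpherical (T N : ℝ → E3) : Prop where
  hasDerivAt : ∀ s, HasDerivAt T (N s) s
  continuous_velocity : Continuous N
  norm_eq : ∀ s, ‖T s‖ = 1
  norm_velocity : ∀ s, ‖N s‖ = 1

namespace IsUnitSpeedSpherical

variable {T N A B : ℝ → E3}

theorem continuous (h : IsUnitSpeedSpherical T N) : Continuous T :=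
  continuous_iff_continuousAt.2 fun s => (h.hasDerivAt s).continuousAt

theorem intervalIntegrable (h : IsUnitSpeedSpherical T N) (a b : ℝ) :
    IntervalIntegrable T MeasureTheory.volume a b :=
  h.continuous.intervalIntegrable a b

theorem comp_add_const (h : IsUnitSpeedSpherical T N) (c : ℝ) :
    IsUnitSpeedSpherical (fun s => T (s + c)) (fun s => N (s + c)) where
  hasDerivAt s := (h.hasDerivAt (s + c)).comp_add_const s c
  continuous_velocity := h.continuous_velocity.comp (by fun_prop)
  norm_eq s := h.norm_eq _
  norm_velocity s := h.norm_velocity _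

/-- Two spherical curves with matching position and velocity can be concatenated. -/
theorem exists_glue (hT : IsUnitSpeedSpherical T N) (hA : IsUnitSpeedSpherical A B) {l : ℝ}
    (h0 : T l = A 0) (h1 : N l = B 0) :
    ∃ G M : ℝ → E3, IsUnitSpeedSpherical G M ∧ (∀ s ≤ l, G s = T s ∧ M s = N s) ∧
      ∀ s, l ≤ s → G s = A (s - l) ∧ M s = B (s - l) := by
  set M : ℝ → E3 := fun s => if s ≤ l then N s else B (s - l) with hM
  have hMc : Continuous M := by
    refine Continuous.if_le hT.continuous_velocity
      (hA.continuous_velocity.comp (by fun_prop)) continuous_id continuous_const ?_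
    rintro s rfl
    simpa using h1
  have hMl : ∀ s ≤ l, M s = N s := fun s hs => by simp [hM, hs]
  have hMr : ∀ s, l ≤ s → M s = B (s - l) := fun s hs => by
    rcases hs.eq_or_lt with rfl | hs
    · simpa [hM] using h1
    · simp [hM, hs.not_ge]
  set G : ℝ → E3 := fun s => T l + ∫ x in l..s, M x with hG
  have hGl : ∀ s ≤ l, G s = T s := fun s hs => by
    have : ∫ x in l..s, M x = ∫ x in l..s, N x :=
      intervalIntegral.integral_congr fun x hx => hMl x (by rw [uIcc_of_ge hs] at hx; exact hx.2)
    simp only [hG, this]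
    rw [intervalIntegral.integral_eq_sub_of_hasDerivAt (fun x _ => hT.hasDerivAt x)
      (hT.continuous_velocity.intervalIntegrable _ _)]
    abel
  have hA' := hA.comp_add_const (-l)
  have hGr : ∀ s, l ≤ s → G s = A (s - l) := fun s hs => by
    have : ∫ x in l..s, M x = ∫ x in l..s, B (x + -l) :=
      intervalIntegral.integral_congr fun x hx => hMr x (by rw [uIcc_of_le hs] at hx; exact hx.1)
    simp only [hG, this]
    rw [intervalIntegral.integral_eq_sub_of_hasDerivAt (fun x _ => hA'.hasDerivAt x)
      (hA'.continuous_velocity.intervalIntegrable _ _)]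
    simp [h0, sub_eq_add_neg]
  refine ⟨G, M, ⟨fun s => (hMc.integral_hasStrictDerivAt l s).hasDerivAt.const_add _, hMc,
    fun s => ?_, fun s => ?_⟩, fun s hs => ⟨hGl s hs, hMl s hs⟩, fun s hs => ⟨hGr s hs, hMr s hs⟩⟩
  · rcases le_total s l with hs | hs
    · rw [hGl s hs, hT.norm_eq]
    · rw [hGr s hs, hA.norm_eq]
  · rcases le_total s l with hs | hs
    · rw [hMl s hs, hT.norm_velocity]
    · rw [hMr s hs, hA.norm_velocity]

/-- A spherical curve that closes up to first order agrees on `[0, L]` with a periodic one. -/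
theorem exists_periodic (hT : IsUnitSpeedSpherical T N) {L : ℝ} (hL : 0 < L)
    (h0 : T L = T 0) (h1 : N L = N 0) :
    ∃ G M : ℝ → E3, IsUnitSpeedSpherical G M ∧ (∀ s, G (s + L) = G s) ∧
      ∀ s ∈ Icc 0 L, G s = T s := by
  have : Fact (0 < L) := ⟨hL⟩
  set M : ℝ → E3 := fun s => AddCircle.liftIco L 0 N (s : AddCircle L) with hM
  have hMc : Continuous M :=
    (AddCircle.liftIco_continuous (by simp [h1]) hT.continuous_velocity.continuousOn).comp
      (AddCircle.continuous_mk' L)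
  have hMp : Function.Periodic M L := fun s => by simp [hM]
  have hMe : ∀ s ∈ Icc 0 L, M s = N s := fun s hs => by
    rcases hs.2.eq_or_lt with rfl | hs'
    · have : M s = M 0 := by simpa using hMp 0
      rw [this, h1]
      exact AddCircle.liftIco_coe_apply (by simpa using hL)
    · exact AddCircle.liftIco_coe_apply (by simpa using ⟨hs.1, hs'⟩)
  set G : ℝ → E3 := fun s => T 0 + ∫ x in (0 : ℝ)..s, M x with hG
  have hGe : ∀ s ∈ Icc 0 L, G s = T s := fun s hs => by
    have : ∫ x in (0 : ℝ)..s, M x = ∫ x in (0 : ℝ)..s, N x :=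
      intervalIntegral.integral_congr fun x hx =>
        hMe x (by rw [uIcc_of_le hs.1] at hx; exact ⟨hx.1, hx.2.trans hs.2⟩)
    simp only [hG, this]
    rw [intervalIntegral.integral_eq_sub_of_hasDerivAt (fun x _ => hT.hasDerivAt x)
      (hT.continuous_velocity.intervalIntegrable _ _)]
    abel
  have hI : ∫ x in (0 : ℝ)..L, M x = 0 := by
    have := hGe L ⟨hL.le, le_rfl⟩
    simpa [hG, h0] using this
  have hGp : Function.Periodic G L := fun s => by
    simp only [hG]
    rw [← intervalIntegral.integral_add_adjacent_intervals (hMc.intervalIntegrable 0 s)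
      (hMc.intervalIntegrable s (s + L)), hMp.intervalIntegral_add_eq s 0]
    simp [hI]
  refine ⟨G, M, ⟨fun s => (hMc.integral_hasStrictDerivAt 0 s).hasDerivAt.const_add _, hMc,
    fun s => ?_, fun s => ?_⟩, hGp, hGe⟩
  · obtain ⟨y, hy, hxy⟩ := hGp.exists_mem_Ico₀ hL s
    rw [hxy, hGe y ⟨hy.1, hy.2.le⟩, hT.norm_eq]
  · obtain ⟨y, hy, hxy⟩ := hMp.exists_mem_Ico₀ hL s
    rw [hxy, hMe y ⟨hy.1, hy.2.le⟩, hT.norm_velocity]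

end IsUnitSpeedSpherical

theorem integral_eq_of_eqOn_Iic {G T : ℝ → E3} {l a b : ℝ} (h : ∀ s ≤ l, G s = T s)
    (ha : a ≤ l) (hb : b ≤ l) : ∫ x in a..b, G x = ∫ x in a..b, T x :=
  intervalIntegral.integral_congr fun x hx => h x (hx.2.trans (max_le ha hb))

theorem integral_eq_of_eqOn_Ici {G A : ℝ → E3} {l a b : ℝ} (h : ∀ s, l ≤ s → G s = A (s - l))
    (ha : l ≤ a) (hb : l ≤ b) : ∫ x in a..b, G x = ∫ x in (a - l)..(b - l), A x := by
  rw [← intervalIntegral.integral_comp_sub_right]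
  exact intervalIntegral.integral_congr fun x hx => h x ((le_min ha hb).trans hx.1)

theorem norm_sq_orthonormal_comb {x w n : E3} (hx : ‖x‖ = 1) (hw : ‖w‖ = 1) (hn : ‖n‖ = 1)
    (hxw : inner ℝ x w = 0) (hxn : inner ℝ x n = 0) (hwn : inner ℝ w n = 0) (a b c : ℝ) :
    ‖a • x + b • w + c • n‖ ^ 2 = a ^ 2 + b ^ 2 + c ^ 2 := by
  rw [norm_add_sq_real, norm_add_sq_real]
  simp only [inner_add_left, inner_smul_left, inner_smul_right, hxw, hxn, hwn, norm_smul, hx, hw,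
    hn, mul_one, Real.norm_eq_abs, sq_abs]
  simp

/-- The circle of spherical radius `arcsin β` through `x` with velocity `w`, on the side of `n`. -/
theorem exists_spherical_circle {x w n : E3} (hx : ‖x‖ = 1) (hw : ‖w‖ = 1) (hn : ‖n‖ = 1)
    (hxw : inner ℝ x w = 0) (hxn : inner ℝ x n = 0) (hwn : inner ℝ w n = 0) {β κ : ℝ}
    (hβ : 0 < β) (hκ : κ ^ 2 + β ^ 2 = 1) (m : ℕ) :
    ∃ C N : ℝ → E3, IsUnitSpeedSpherical C N ∧ C 0 = x ∧ N 0 = w ∧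
      C (m * (2 * π * β)) = x ∧ N (m * (2 * π * β)) = w ∧
      ∫ s in (0 : ℝ)..(m * (2 * π * β)), C s = (m * (2 * π * β) * κ) • (κ • x + β • n) ∧
      ∀ s, ‖C s - x‖ ≤ 2 * β := by
  have hcomb := norm_sq_orthonormal_comb hx hw hn hxw hxn hwn
  set C : ℝ → E3 := fun s => κ • (κ • x + β • n) +
    β • (Real.cos (s / β) • (β • x - κ • n) + Real.sin (s / β) • w) with hC
  set N : ℝ → E3 := fun s =>
    -Real.sin (s / β) • (β • x - κ • n) + Real.cos (s / β) • w with hN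
  set P : ℝ → E3 := fun s => (s * κ) • (κ • x + β • n) +
    β ^ 2 • (Real.sin (s / β) • (β • x - κ • n) - Real.cos (s / β) • w) with hP
  have hθ : ∀ s : ℝ, HasDerivAt (fun s : ℝ => s / β) (1 / β) s := fun s =>
    (hasDerivAt_id s).div_const β
  have hCd : ∀ s, HasDerivAt C (N s) s := fun s => by
    have := (((((hθ s).cos.smul_const (β • x - κ • n)).add
      ((hθ s).sin.smul_const w)).const_smul β).const_add (κ • (κ • x + β • n)))
    refine this.congr_deriv ?_
    simp only [hN, smul_add, smul_smul]
    congr 2 <;> field_simp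
  have hPd : ∀ s, HasDerivAt P (C s) s := fun s => by
    have := (((hasDerivAt_id s).mul_const κ).smul_const (κ • x + β • n)).add
      ((((hθ s).sin.smul_const (β • x - κ • n)).sub
      ((hθ s).cos.smul_const w)).const_smul (β ^ 2))
    refine this.congr_deriv ?_
    simp only [hC, smul_add, smul_sub, smul_smul, one_mul]
    match_scalars <;> field_simp
  have hNc : Continuous N := by simp only [hN]; fun_prop
  have hang : (m * (2 * π * β)) / β = m * (2 * π) := by field_simp
  have hcos : Real.cos (m * (2 * π)) = 1 := Real.cos_nat_mul_two_pi m
  have hsin : Real.sin (m * (2 * π)) = 0 := by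
    have := Real.sin_nat_mul_pi (2 * m)
    rw [← this]; push_cast; ring_nf
  have hxx : κ • (κ • x + β • n) + β • (β • x - κ • n) = x := by
    have : κ • (κ • x + β • n) + β • (β • x - κ • n) = (κ ^ 2 + β ^ 2) • x := by module
    rw [this, hκ, one_smul]
  refine ⟨C, N, ⟨hCd, hNc, fun s => ?_, fun s => ?_⟩, ?_, ?_, ?_, ?_, ?_, fun s => ?_⟩
  · have e : C s = (κ ^ 2 + β ^ 2 * Real.cos (s / β)) • x + (β * Real.sin (s / β)) • w +
        (κ * β * (1 - Real.cos (s / β))) • n := by simp only [hC]; module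
    have h2 : ‖C s‖ ^ 2 = 1 := by
      rw [e, hcomb]
      have hs := Real.sin_sq (s / β)
      have hk : κ ^ 2 = 1 - β ^ 2 := by linarith
      have : (β * Real.sin (s / β)) ^ 2 = β ^ 2 * (1 - Real.cos (s / β) ^ 2) := by
        rw [mul_pow, hs]
      rw [this, mul_pow, mul_pow, hk]; ring
    exact (pow_eq_one_iff_of_nonneg (norm_nonneg _) two_ne_zero).1 h2
  · have e : N s = (-Real.sin (s / β) * β) • x + (Real.cos (s / β)) • w +
        (Real.sin (s / β) * κ) • n := by simp only [hN]; module
    have h2 : ‖N s‖ ^ 2 = 1 := by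
      rw [e, hcomb]
      have hs := Real.sin_sq_add_cos_sq (s / β)
      linear_combination (Real.sin (s / β)) ^ 2 * hκ + hs
    exact (pow_eq_one_iff_of_nonneg (norm_nonneg _) two_ne_zero).1 h2
  · simp only [hC, zero_div, Real.cos_zero, Real.sin_zero, one_smul, zero_smul, add_zero, hxx]
  · simp [hN]
  · simp only [hC, hang, hcos, hsin, one_smul, zero_smul, add_zero, hxx]
  · simp [hN, hang, hcos, hsin]
  · have hCc : Continuous C := continuous_iff_continuousAt.2 fun s => (hCd s).continuousAt
    rw [intervalIntegral.integral_eq_sub_of_hasDerivAt (fun s _ => hPd s)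
      (hCc.intervalIntegrable _ _)]
    simp only [hP, hang, hcos, hsin, zero_mul, zero_div, Real.cos_zero, Real.sin_zero]
    module
  · have e : C s - x = (β ^ 2 * (Real.cos (s / β) - 1)) • x + (β * Real.sin (s / β)) • w +
        (κ * β * (1 - Real.cos (s / β))) • n := by
      have : C s - (κ • (κ • x + β • n) + β • (β • x - κ • n)) =
          (β ^ 2 * (Real.cos (s / β) - 1)) • x + (β * Real.sin (s / β)) • w +
            (κ * β * (1 - Real.cos (s / β))) • n := by simp only [hC]; module
      rwa [hxx] at this
    have h2 : ‖C s - x‖ ^ 2 ≤ (2 * β) ^ 2 := by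
      rw [e, hcomb]
      have hs := Real.sin_sq (s / β)
      have : (β ^ 2 * (Real.cos (s / β) - 1)) ^ 2 + (β * Real.sin (s / β)) ^ 2 +
        (κ * β * (1 - Real.cos (s / β))) ^ 2 = β ^ 2 * (2 - 2 * Real.cos (s / β)) := by
        have hk : κ ^ 2 = 1 - β ^ 2 := by linarith
        rw [mul_pow β, hs, mul_pow (κ * β), mul_pow κ, hk]; ring
      rw [this]
      have := Real.neg_one_le_cos (s / β)
      nlinarith [sq_nonneg β]
    exact (sq_le_sq₀ (norm_nonneg _) (by positivity)).1 h2

theorem exists_unit_orthogonal_pair (x w : E3) :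
    ∃ n : E3, ‖n‖ = 1 ∧ inner ℝ x n = 0 ∧ inner ℝ w n = 0 := by
  set S : Submodule ℝ E3 := Submodule.span ℝ {x, w} with hS
  have hle : Module.finrank ℝ S ≤ 2 := by
    have h := finrank_span_finset_le_card (R := ℝ) ({x, w} : Finset E3)
    simp only [Finset.coe_insert, Finset.coe_singleton] at h
    exact h.trans Finset.card_le_two
  have hsum := S.finrank_add_finrank_orthogonal
  have h3 : Module.finrank ℝ E3 = 3 := by simp
  have : Nontrivial Sᗮ := Module.nontrivial_of_finrank_pos (R := ℝ) (by omega)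
  obtain ⟨⟨n, hn⟩, hne⟩ := exists_ne (0 : Sᗮ)
  have hne' : n ≠ 0 := fun h => hne (by simpa using h)
  rw [Submodule.mem_orthogonal] at hn
  refine ⟨‖n‖⁻¹ • n, by rw [norm_smul, norm_inv, norm_norm, inv_mul_cancel₀ (by simpa)], ?_, ?_⟩
  · rw [inner_smul_right, hn x (Submodule.subset_span (by simp)), mul_zero]
  · rw [inner_smul_right, hn w (Submodule.subset_span (by simp)), mul_zero]

/-- Small loops at `x` with velocity `w`, with total displacement `c • x` and nearly minimal
length. -/
theorem exists_loop {x w : E3} (hx : ‖x‖ = 1) (hw : ‖w‖ = 1) (hxw : inner ℝ x w = 0)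
    {c ρ : ℝ} (hc : 0 < c) (hρ : 0 < ρ) :
    ∃ (l : ℝ) (C N : ℝ → E3), c ≤ l ∧ l ≤ c * (1 + ρ) ∧ IsUnitSpeedSpherical C N ∧
      C 0 = x ∧ N 0 = w ∧ C l = x ∧ N l = w ∧ ∫ s in (0 : ℝ)..l, C s = c • x ∧
      ∀ s, ‖C s - x‖ ≤ ρ := by
  obtain ⟨n, hn, hxn, hwn⟩ := exists_unit_orthogonal_pair x w
  set β₀ : ℝ := min (1 / 2) (ρ / 2) with hβ₀
  have hβ₀pos : 0 < β₀ := by positivity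
  have hβ₀1 : β₀ ≤ 1 / 2 := min_le_left _ _
  have hβ₀2 : β₀ ≤ ρ / 2 := min_le_right _ _
  have hf₀ : 0 < β₀ * (1 - β₀ ^ 2) := mul_pos hβ₀pos (by nlinarith)
  obtain ⟨m, hm⟩ := exists_nat_gt (c / (4 * π * (β₀ * (1 - β₀ ^ 2))))
  have hmpos : (0 : ℝ) < m := lt_of_le_of_lt (by positivity) hm
  rw [div_lt_iff₀ (by positivity)] at hm
  have hivt : c / (4 * π * m) ∈ (fun β : ℝ => β * (1 - β ^ 2)) '' Icc 0 β₀ := by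
    refine intermediate_value_Icc hβ₀pos.le (by fun_prop) ⟨?_, ?_⟩
    · simp only [zero_mul]; positivity
    · rw [div_le_iff₀ (by positivity)]; nlinarith
  obtain ⟨β, ⟨hβ0, hβ1⟩, hβ⟩ := hivt
  have hβpos : 0 < β := by
    rcases hβ0.eq_or_lt with rfl | h
    · simp only [zero_mul] at hβ
      have : 0 < c / (4 * π * m) := by positivity
      linarith
    · exact h
  have hβ2 : β ^ 2 ≤ 1 / 4 := by nlinarith
  set κ := √(1 - β ^ 2) with hκdef
  have hκ2 : κ ^ 2 = 1 - β ^ 2 := Real.sq_sqrt (by linarith)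
  have hκ : κ ^ 2 + β ^ 2 = 1 := by linarith
  have hβc : 4 * π * m * (β * (1 - β ^ 2)) = c := by
    simp only [] at hβ
    rw [hβ]; field_simp
  obtain ⟨C₁, N₁, h₁, a₁, b₁, c₁, d₁, e₁, f₁⟩ :=
    exists_spherical_circle hx hw hn hxw hxn hwn hβpos hκ m
  obtain ⟨C₂, N₂, h₂, a₂, b₂, c₂, d₂, e₂, f₂⟩ :=
    exists_spherical_circle (n := -n) hx hw (by simpa) hxw (by simpa) (by simpa) hβpos hκ m
  set p := m * (2 * π * β) with hp
  have hppos : 0 < p := by positivity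
  obtain ⟨G, M, hG, hGl, hGr⟩ := h₁.exists_glue h₂ (c₁.trans a₂.symm) (d₁.trans b₂.symm)
  have hl : 2 * p * (1 - β ^ 2) = c := by rw [← hβc, hp]; ring
  refine ⟨2 * p, G, M, ?_, ?_, hG, ?_, ?_, ?_, ?_, ?_, fun s => ?_⟩
  · nlinarith
  · rw [← hl]
    have hβρ : β ≤ ρ / 2 := hβ1.trans hβ₀2
    have h1 : 1 ≤ (1 - β ^ 2) * (1 + ρ) := by nlinarith
    nlinarith
  · rw [(hGl 0 hppos.le).1, a₁]
  · rw [(hGl 0 hppos.le).2, b₁]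
  · rw [(hGr (2 * p) (by linarith)).1]; convert c₂ using 2; ring
  · rw [(hGr (2 * p) (by linarith)).2]; convert d₂ using 2; ring
  · rw [← intervalIntegral.integral_add_adjacent_intervals (hG.intervalIntegrable 0 p)
      (hG.intervalIntegrable p (2 * p)),
      integral_eq_of_eqOn_Iic (fun s hs => (hGl s hs).1) hppos.le le_rfl,
      integral_eq_of_eqOn_Ici (fun s hs => (hGr s hs).1) le_rfl (by linarith), sub_self,
      show 2 * p - p = p by ring, e₁, e₂, ← hl]
    have : (p * κ) • (κ • x + β • n) + (p * κ) • (κ • x + β • -n) = (2 * p * κ ^ 2) • x := by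
      module
    rw [this, hκ2]
  · rcases le_total s p with hs | hs
    · rw [(hGl s hs).1]; exact (f₁ s).trans (by linarith)
    · rw [(hGr s hs).1]; exact (f₂ _).trans (by linarith)

/-- There is a unit speed spherical curve from `(x, w)` to `(y, z)` with integral `d` whose
primitive, suitably reparametrised over `[a, b]`, follows `K • γ` up to a `K * ε`-Lipschitz
error. -/
def Shadows (γ : ℝ → E3) (K ε a b : ℝ) (x w y z d : E3) : Prop :=
  ∃ (l : ℝ) (T N : ℝ → E3) (φ : ℝ → ℝ), 0 < l ∧ IsUnitSpeedSpherical T N ∧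
    T 0 = x ∧ N 0 = w ∧ T l = y ∧ N l = z ∧ Continuous φ ∧ Monotone φ ∧ φ a = 0 ∧ φ b = l ∧
    ∫ u in (0 : ℝ)..l, T u = d ∧
    ∀ s t, a ≤ s → s ≤ t → t ≤ b →
      ‖(∫ u in (φ s)..(φ t), T u) - K • (γ t - γ s)‖ ≤ K * ε * (t - s)

theorem Shadows.trans {γ : ℝ → E3} {K ε a b c : ℝ} {x w y z x' w' d d' : E3} (hab : a ≤ b)
    (hbc : b ≤ c) (h₁ : Shadows γ K ε a b x w y z d) (h₂ : Shadows γ K ε b c y z x' w' d') :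
    Shadows γ K ε a c x w x' w' (d + d') := by
  obtain ⟨l₁, T₁, N₁, φ₁, hl₁, hT₁, rfl, rfl, hy₁, hz₁, hφ₁, hm₁, ha₁, hb₁, hd₁, hc₁⟩ := h₁
  obtain ⟨l₂, T₂, N₂, φ₂, hl₂, hT₂, hx₂, hw₂, hy₂, hz₂, hφ₂, hm₂, ha₂, hb₂, hd₂, hc₂⟩ := h₂
  obtain ⟨G, M, hG, hGl, hGr⟩ := hT₁.exists_glue hT₂ (hy₁.trans hx₂.symm) (hz₁.trans hw₂.symm)
  set φ : ℝ → ℝ := fun t => if t ≤ b then φ₁ t else l₁ + φ₂ t with hφ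
  have hφl : ∀ t ≤ b, φ t = φ₁ t := fun t ht => by simp [hφ, ht]
  have hφr : ∀ t, b ≤ t → φ t = l₁ + φ₂ t := fun t ht => by
    rcases ht.eq_or_lt with rfl | ht
    · simp [hφ, hb₁, ha₂]
    · simp [hφ, ht.not_ge]
  have hle₁ : ∀ t ≤ b, φ₁ t ≤ l₁ := fun t ht => hb₁ ▸ hm₁ ht
  have hle₂ : ∀ t, b ≤ t → 0 ≤ φ₂ t := fun t ht => ha₂ ▸ hm₂ ht
  have hint₁ : ∀ s t, s ≤ b → t ≤ b → ∫ u in (φ s)..(φ t), G u = ∫ u in (φ₁ s)..(φ₁ t), T₁ u := by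
    intro s t hs ht
    rw [hφl s hs, hφl t ht]
    exact integral_eq_of_eqOn_Iic (fun s hs => (hGl s hs).1) (hle₁ s hs) (hle₁ t ht)
  have hint₂ : ∀ s t, b ≤ s → b ≤ t → ∫ u in (φ s)..(φ t), G u = ∫ u in (φ₂ s)..(φ₂ t), T₂ u := by
    intro s t hs ht
    rw [hφr s hs, hφr t ht, integral_eq_of_eqOn_Ici (fun s hs => (hGr s hs).1)
      (by linarith [hle₂ s hs]) (by linarith [hle₂ t ht])]
    simp
  refine ⟨l₁ + l₂, G, M, φ, by linarith, hG, (hGl 0 hl₁.le).1, (hGl 0 hl₁.le).2, ?_, ?_, ?_, ?_,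
    ?_, ?_, ?_, ?_⟩
  · rw [(hGr _ (by linarith)).1, ← hy₂]; simp
  · rw [(hGr _ (by linarith)).2, ← hz₂]; simp
  · refine Continuous.if_le hφ₁ (by fun_prop) continuous_id continuous_const ?_
    rintro t rfl
    simp [hb₁, ha₂]
  · intro s t hst
    rcases le_total t b with ht | ht
    · rw [hφl s (hst.trans ht), hφl t ht]; exact hm₁ hst
    · rcases le_total s b with hs | hs
      · rw [hφl s hs, hφr t ht]; linarith [hle₁ s hs, hle₂ t ht]
      · rw [hφr s hs, hφr t ht]; linarith [hm₂ hst]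
  · rw [hφl a hab, ha₁]
  · rw [hφr c hbc, hb₂]
  · rw [← intervalIntegral.integral_add_adjacent_intervals (hG.intervalIntegrable 0 l₁)
      (hG.intervalIntegrable l₁ (l₁ + l₂)),
      integral_eq_of_eqOn_Iic (fun s hs => (hGl s hs).1) hl₁.le le_rfl,
      integral_eq_of_eqOn_Ici (fun s hs => (hGr s hs).1) le_rfl (by linarith), hd₁]
    simp [hd₂]
  · intro s t has hst htc
    rcases le_total t b with ht | ht
    · rw [hint₁ s t (hst.trans ht) ht]; exact hc₁ s t has hst ht
    rcases le_total s b with hs | hs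
    · rw [← intervalIntegral.integral_add_adjacent_intervals (hG.intervalIntegrable (φ s) (φ b))
        (hG.intervalIntegrable (φ b) (φ t)), hint₁ s b hs le_rfl, hint₂ b t le_rfl ht]
      have e₁ := hc₁ s b has hs le_rfl
      have e₂ := hc₂ b t le_rfl ht htc
      have : ∀ I J : E3, I + J - K • (γ t - γ s) =
          (I - K • (γ b - γ s)) + (J - K • (γ t - γ b)) := fun I J => by module
      rw [this]
      refine (norm_add_le _ _).trans ?_
      linarith
    · rw [hint₂ s t hs (hs.trans hst)]; exact hc₂ s t hs hst htc

theorem Shadows.chain {γ : ℝ → E3} {K ε : ℝ} {τ : ℕ → ℝ} (hτ : Monotone τ) {x w d : ℕ → E3}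
    (k : ℕ) (h : ∀ i ≤ k, Shadows γ K ε (τ i) (τ (i + 1)) (x i) (w i) (x (i + 1)) (w (i + 1)) (d i)) :
    Shadows γ K ε (τ 0) (τ (k + 1)) (x 0) (w 0) (x (k + 1)) (w (k + 1))
      (∑ i ∈ Finset.range (k + 1), d i) := by
  induction k with
  | zero => simpa using h 0 le_rfl
  | succ k ih =>
    rw [Finset.sum_range_succ]
    exact (ih fun i hi => h i (by omega)).trans (hτ (Nat.zero_le _)) (hτ (Nat.le_succ _))
      (h (k + 1) le_rfl)

/-- A curve staying close to the direction `y` follows a nearly straight piece of `γ`. -/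
theorem IsUnitSpeedSpherical.shadows {T N : ℝ → E3} (hT : IsUnitSpeedSpherical T N)
    {γ : ℝ → E3} {K ε ε₁ ε₂ δ a b l : ℝ} {y v : E3} (hK : 0 ≤ K) (hab : a < b) (hl : 0 < l)
    (hy : ∀ s ∈ Icc 0 l, ‖T s - y‖ ≤ δ)
    (hv : ‖(l / (b - a)) • y - K • v‖ ≤ K * ε₁)
    (hγ : ∀ s t, a ≤ s → s ≤ t → t ≤ b → ‖γ t - γ s - (t - s) • v‖ ≤ ε₂ * (t - s))
    (hε : δ * (l / (b - a)) + K * ε₁ + K * ε₂ ≤ K * ε) :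
    Shadows γ K ε a b (T 0) (N 0) (T l) (N l) (∫ u in (0 : ℝ)..l, T u) := by
  have hba : 0 < b - a := sub_pos.2 hab
  have hq : 0 < l / (b - a) := by positivity
  refine ⟨l, T, N, fun t => l / (b - a) * (t - a), hl, hT, rfl, rfl, rfl, rfl, by fun_prop,
    fun s t hst => by simp only; gcongr, by simp, by field_simp, rfl, fun s t has hst htb => ?_⟩
  set q := l / (b - a) with hqdef
  have hql : q * (b - a) = l := by rw [hqdef]; field_simp
  have hst' : q * (s - a) ≤ q * (t - a) := by gcongr
  have h1 : ‖(∫ u in (q * (s - a))..(q * (t - a)), T u) - (q * (t - s)) • y‖ ≤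
      δ * (q * (t - s)) := by
    have e : (∫ u in (q * (s - a))..(q * (t - a)), T u) - (q * (t - s)) • y =
        ∫ u in (q * (s - a))..(q * (t - a)), (T u - y) := by
      rw [intervalIntegral.integral_sub (hT.intervalIntegrable _ _)
        (continuous_const.intervalIntegrable _ _), intervalIntegral.integral_const]
      congr 2; ring
    rw [e]
    have := intervalIntegral.norm_integral_le_of_norm_le_const (f := fun u => T u - y)
      (a := q * (s - a)) (b := q * (t - a)) (C := δ) (fun u hu => hy u ?_)
    · refine this.trans_eq ?_
      rw [abs_of_nonneg (by linarith)]; ring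
    · rw [uIoc_of_le hst'] at hu
      have h0 : 0 ≤ q * (s - a) := mul_nonneg hq.le (by linarith)
      have h2 : q * (t - a) ≤ q * (b - a) := by gcongr
      exact ⟨by linarith [hu.1], by linarith [hu.2]⟩
  have h2 : ‖(t - s) • (q • y - K • v)‖ ≤ (t - s) * (K * ε₁) := by
    rw [norm_smul, Real.norm_of_nonneg (by linarith)]
    exact mul_le_mul_of_nonneg_left hv (by linarith)
  have h3 : ‖K • (γ t - γ s - (t - s) • v)‖ ≤ K * (ε₂ * (t - s)) := by
    rw [norm_smul, Real.norm_of_nonneg hK]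
    exact mul_le_mul_of_nonneg_left (hγ s t has hst htb) hK
  have key : ∀ I : E3, I - K • (γ t - γ s) = (I - (q * (t - s)) • y) +
      (t - s) • (q • y - K • v) - K • (γ t - γ s - (t - s) • v) := fun I => by module
  rw [key]
  refine (norm_sub_le _ _).trans ((add_le_add_left (norm_add_le _ _) _).trans ?_)
  have : (δ * q + K * ε₁ + K * ε₂) * (t - s) ≤ K * ε * (t - s) :=
    mul_le_mul_of_nonneg_right hε (by linarith)
  linarith

theorem deriv_add_period {E : Type*} [NormedAddCommGroup E] [NormedSpace ℝ E] {f : ℝ → E} {c : ℝ}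
    (h : ∀ s, f (s + c) = f s) (s : ℝ) : deriv f (s + c) = deriv f s := by
  rw [← deriv_comp_add_const]
  exact congrArg (fun g => deriv g s) (funext h)

/-- The direction of a closed curve `v` that is nowhere parallel to its velocity can be
parametrised by arc length. -/
theorem exists_unitSpeed_direction {v : ℝ → E3} (hv : ContDiff ℝ 1 v)
    (hper : ∀ t, v (t + 1) = v t) (hne : ∀ t, v t ≠ 0) (hli : ∀ (t c : ℝ), deriv v t ≠ c • v t) :
    ∃ (T N : ℝ → E3) (σ : ℝ → ℝ), IsUnitSpeedSpherical T N ∧ StrictMono σ ∧ Continuous σ ∧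
      σ 0 = 0 ∧ (∀ t, T (σ t) = ‖v t‖⁻¹ • v t) ∧ T (σ 1) = T 0 ∧ N (σ 1) = N 0 := by
  have hf : ContDiff ℝ 1 fun t => ‖v t‖ := hv.norm ℝ hne
  have hf0 : ∀ t, ‖v t‖ ≠ 0 := fun t => norm_ne_zero_iff.2 (hne t)
  set U : ℝ → E3 := fun t => ‖v t‖⁻¹ • v t with hU
  have hUc : ContDiff ℝ 1 U := (hf.inv hf0).smul hv
  have hUd : ∀ t, HasDerivAt U (deriv U t) t := fun t =>
    (hUc.differentiable one_ne_zero t).hasDerivAt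
  have hU'c : Continuous (deriv U) := hUc.continuous_deriv le_rfl
  have hUper : ∀ t, U (t + 1) = U t := fun t => by simp only [hU, hper]
  have hU'0 : ∀ t, deriv U t ≠ 0 := fun t h0 => by
    have hvU : v = fun t => ‖v t‖ • U t := by
      funext s
      simp only [hU, smul_smul, mul_inv_cancel₀ (hf0 s), one_smul]
    have h1 := ((hf.differentiable one_ne_zero t).hasDerivAt.smul (hUd t)).deriv
    have h2 : deriv v t = deriv (fun t => ‖v t‖) t • U t := by
      rw [h0, smul_zero, zero_add] at h1
      rw [← h1]
      exact congrArg (fun g => deriv g t) hvU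
    exact hli t _ (by rw [h2, smul_smul])
  set g : ℝ → ℝ := fun t => ‖deriv U t‖ with hg
  have hgc : Continuous g := hU'c.norm
  have hgpos : ∀ t, 0 < g t := fun t => norm_pos_iff.2 (hU'0 t)
  have hgper : Function.Periodic g 1 := fun t => by simp only [hg, deriv_add_period hUper]
  set σ : ℝ → ℝ := fun t => ∫ x in (0 : ℝ)..t, g x with hσ
  have hσd : ∀ t, HasDerivAt σ (g t) t := fun t => (hgc.integral_hasStrictDerivAt 0 t).hasDerivAt
  have hσm : StrictMono σ := strictMono_of_hasDerivAt_pos hσd hgpos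
  have hσc : Continuous σ := continuous_iff_continuousAt.2 fun t => (hσd t).continuousAt
  have hint : ∀ a b, IntervalIntegrable g MeasureTheory.volume a b := fun a b =>
    hgc.intervalIntegrable a b
  have hσs : Function.Surjective σ := hσc.surjective
    (hgper.tendsto_atTop_intervalIntegral_of_pos' (hint _ _) hgpos one_pos)
    (hgper.tendsto_atBot_intervalIntegral_of_pos' (hint _ _) hgpos one_pos)
  set e := (hσm.orderIsoOfSurjective σ hσs).toHomeomorph with he
  have heσ : ∀ t, e t = σ t := fun t => rfl
  have hes : ∀ t, e.symm (σ t) = t := fun t => by rw [← heσ]; exact e.symm_apply_apply t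
  have hed : ∀ s, HasDerivAt e.symm (g (e.symm s))⁻¹ s := fun s =>
    HasDerivAt.of_local_left_inverse e.symm.continuous.continuousAt (hσd _) (hgpos _).ne'
      (Filter.Eventually.of_forall fun y => e.apply_symm_apply y)
  have hσ0 : σ 0 = 0 := by simp [hσ]
  have he0 : e.symm 0 = 0 := by rw [← hσ0]; simpa [hσ0] using hes 0
  refine ⟨fun s => U (e.symm s), fun s => (g (e.symm s))⁻¹ • deriv U (e.symm s), σ,
    ⟨fun s => (hUd _).scomp s (hed s), ?_, fun s => ?_, fun s => ?_⟩, hσm, hσc, hσ0,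
    fun t => by simp only [hes]; rfl, ?_, ?_⟩
  · exact ((hgc.comp e.symm.continuous).inv₀ fun s => (hgpos _).ne').smul
      (hU'c.comp e.symm.continuous)
  · simp only [hU, norm_smul, norm_inv, norm_norm, inv_mul_cancel₀ (hf0 _)]
  · rw [norm_smul, norm_inv, Real.norm_of_nonneg (hgpos _).le]
    exact inv_mul_cancel₀ (hgpos _).ne'
  · simp only [hes, he0]
    simpa using hUper 0
  · simp only [hes, he0]
    have h1 := deriv_add_period hUper 0
    rw [zero_add] at h1
    have h2 := hgper 0
    rw [zero_add] at h2
    rw [h1, h2]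

theorem norm_image_sub_sub_smul_le {f f' : ℝ → E3} (hf : ∀ x, HasDerivAt f (f' x) x) {c : E3}
    {ε a b : ℝ} (hab : a ≤ b) (h : ∀ x ∈ Icc a b, ‖f' x - c‖ ≤ ε) :
    ‖f b - f a - (b - a) • c‖ ≤ ε * (b - a) := by
  have := norm_image_sub_le_of_norm_deriv_le_segment' (f := fun x => f x - x • c)
    (f' := fun x => f' x - c) (a := a) (b := b) (C := ε)
    (fun x _ => by
      have := ((hf x).sub ((hasDerivAt_id x).smul_const c)).hasDerivWithinAt (s := Icc a b)
      simp only [one_smul] at this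
      exact this)
    (fun x hx => h x ⟨hx.1, hx.2.le⟩) b ⟨hab, le_rfl⟩
  have e : f b - f a - (b - a) • c = (f b - b • c) - (f a - a • c) := by module
  rw [e]
  exact this

theorem exists_modulus_of_periodic {f : ℝ → E3} (hf : Continuous f) (hper : ∀ s, f (s + 1) = f s)
    {ε : ℝ} (hε : 0 < ε) : ∃ δ > 0, ∀ s t, |s - t| ≤ δ → ‖f s - f t‖ ≤ ε := by
  have huc := isCompact_Icc (a := (-1 : ℝ)) (b := 2) |>.uniformContinuousOn_of_continuous
    hf.continuousOn
  obtain ⟨δ, hδ, h⟩ := Metric.uniformContinuousOn_iff_le.1 huc ε hε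
  refine ⟨min δ 1, by positivity, fun s t hst => ?_⟩
  have hz : ∀ (n : ℤ) x, f (x - n) = f x := fun n x => by
    have := (show Function.Periodic f 1 from hper).sub_int_mul_eq (x := x) n
    simpa using this
  have h1 := Int.floor_le s
  have h2 := Int.lt_floor_add_one s
  have h3 := abs_le.1 (hst.trans (min_le_right _ _))
  have := h (s - ⌊s⌋) ⟨by linarith, by linarith⟩ (t - ⌊s⌋) ⟨by linarith, by linarith⟩
    (by rw [Real.dist_eq, sub_sub_sub_cancel_right]; exact hst.trans (min_le_left _ _))
  rwa [hz, hz, dist_eq_norm] at this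

theorem exists_smooth_tangent_approx {γ : ℝ → E3} (hper : ∀ s, γ (s + 1) = γ s)
    (hC : ContDiff ℝ 1 γ) {ε : ℝ} (hε : 0 < ε) :
    ∃ (n : ℕ) (v : ℝ → E3), 2 ≤ n ∧ ContDiff ℝ 2 v ∧ (∀ s, v (s + 1) = v s) ∧
      ∑ i ∈ Finset.range n, v (i / n) = 0 ∧
      ∀ s t : ℝ, |s - t| ≤ 1 / n → ‖v s - deriv γ t‖ ≤ ε := by
  obtain ⟨δ, hδ, hmod⟩ := exists_modulus_of_periodic (hC.continuous_deriv le_rfl)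
    (deriv_add_period hper) hε
  have hγd : ∀ t, HasDerivAt γ (deriv γ t) t := fun t =>
    (hC.differentiable one_ne_zero t).hasDerivAt
  obtain ⟨n, hn⟩ := exists_nat_gt (max 2 (3 / δ))
  have hn2 : (2 : ℝ) < n := (le_max_left _ _).trans_lt hn
  have hn0 : (0 : ℝ) < n := by linarith
  have hnδ : 3 * (1 / (n : ℝ)) ≤ δ := by
    have := (le_max_right _ _).trans_lt hn
    rw [div_lt_iff₀ hδ] at this
    rw [mul_one_div, div_le_iff₀ hn0]; linarith
  set h : ℝ := 1 / n with hh
  have hhpos : 0 < h := by positivity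
  have hnh : (n : ℝ) * h = 1 := by rw [hh]; field_simp
  set Γ : ℝ → E3 := fun x => ∫ u in (0 : ℝ)..x, γ u with hΓ
  have hΓd : ∀ x, HasDerivAt Γ (γ x) x := fun x =>
    (hC.continuous.integral_hasStrictDerivAt 0 x).hasDerivAt
  have hΓC : ContDiff ℝ 2 Γ := by
    rw [show (2 : WithTop ℕ∞) = 1 + 1 by norm_num, contDiff_succ_iff_deriv]
    refine ⟨fun x => (hΓd x).differentiableAt, by simp, ?_⟩
    rwa [show deriv Γ = γ from funext fun x => (hΓd x).deriv]
  have hΓp : ∀ x, Γ (x + 1) = Γ x + Γ 1 := fun x => by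
    simp only [hΓ]
    rw [← intervalIntegral.integral_add_adjacent_intervals (hC.continuous.intervalIntegrable 0 x)
      (hC.continuous.intervalIntegrable x (x + 1)),
      Function.Periodic.intervalIntegral_add_eq hper x 0, zero_add]
  set w : ℝ → E3 := fun x => (n : ℝ) • (Γ (x + h) - Γ x) with hw
  have hwC : ContDiff ℝ 2 w := by
    have : ContDiff ℝ 2 fun x : ℝ => Γ (x + h) := hΓC.comp (contDiff_id.add contDiff_const)
    exact (this.sub hΓC).const_smul (n : ℝ)
  have hwp : ∀ x, w (x + 1) = w x := fun x => by
    simp only [hw]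
    rw [show x + 1 + h = (x + h) + 1 by ring, hΓp, hΓp]
    congr 1; abel
  have hwd : ∀ x, HasDerivAt w ((n : ℝ) • (γ (x + h) - γ x)) x := fun x =>
    (((hΓd (x + h)).comp_add_const x h).sub (hΓd x)).const_smul (n : ℝ)
  refine ⟨n, fun x => (n : ℝ) • (w (x + h) - w x), by exact_mod_cast hn2.le, ?_, fun s => ?_, ?_,
    fun s t hst => ?_⟩
  · have : ContDiff ℝ 2 fun x : ℝ => w (x + h) := hwC.comp (contDiff_id.add contDiff_const)
    exact (this.sub hwC).const_smul (n : ℝ)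
  · simp only [show s + 1 + h = (s + h) + 1 by ring, hwp]
  · have : ∀ i : ℕ, (n : ℝ) • (w (i / n + h) - w (i / n)) =
        (n : ℝ) • (w (((i + 1 : ℕ) : ℝ) / n) - w (i / n)) := fun i => by
      rw [show ((i + 1 : ℕ) : ℝ) / n = i / n + h by rw [hh]; push_cast; ring]
    simp only [this]
    rw [← Finset.smul_sum, Finset.sum_range_sub (fun i : ℕ => w ((i : ℝ) / n))]
    have h1 := hwp 0
    rw [zero_add] at h1
    simp [div_self hn0.ne', h1]
  · have hst' := abs_le.1 hst
    have scale : ∀ x y c : E3, ‖x - y - h • c‖ ≤ ε * h → ‖(n : ℝ) • (x - y) - c‖ ≤ ε := by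
      intro x y c hxy
      have e : (n : ℝ) • (x - y) - c = (n : ℝ) • (x - y - h • c) := by
        rw [smul_sub _ (x - y), smul_smul, hnh, one_smul]
      rw [e, norm_smul, Real.norm_of_nonneg hn0.le]
      calc n * ‖x - y - h • c‖ ≤ n * (ε * h) := by gcongr
        _ = ε * (n * h) := by ring
        _ = ε := by rw [hnh, mul_one]
    refine scale _ _ _ ?_
    have := norm_image_sub_sub_smul_le hwd (c := deriv γ t) (ε := ε)
      (by linarith : s ≤ s + h) fun x hx => scale _ _ _ ?_
    · rwa [add_sub_cancel_left] at this
    · have := norm_image_sub_sub_smul_le hγd (c := deriv γ t) (ε := ε)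
        (by linarith : x ≤ x + h) fun y hy => hmod _ _ ?_
      · rwa [add_sub_cancel_left] at this
      · rw [abs_le]
        constructor <;> linarith [hx.1, hx.2, hy.1, hy.2, hst'.1, hst'.2]

/-- A generic trigonometric perturbation of a closed curve is nowhere parallel to its velocity. -/
theorem exists_generic_perturbation {v : ℝ → E3} (hv : ContDiff ℝ 2 v) {ε : ℝ} (hε : 0 < ε) :
    ∃ p q : E3, ‖p‖ ≤ ε ∧ ‖q‖ ≤ ε ∧ ∀ t c : ℝ,
      deriv (fun t => v t + (Real.cos (2 * π * t) • p + Real.sin (2 * π * t) • q)) t ≠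
        c • (v t + (Real.cos (2 * π * t) • p + Real.sin (2 * π * t) • q)) := by
  set A : ℝ × ℝ × E3 → ℝ := fun x =>
    -(2 * π * Real.sin (2 * π * x.1)) - x.2.1 * Real.cos (2 * π * x.1) with hA
  set B : ℝ × ℝ × E3 → ℝ := fun x =>
    2 * π * Real.cos (2 * π * x.1) - x.2.1 * Real.sin (2 * π * x.1) with hB
  set m : ℝ × ℝ × E3 → E3 := fun x => x.2.1 • v x.1 - deriv v x.1 with hm
  have hAC : ContDiff ℝ 1 A := by simp only [hA]; fun_prop
  have hBC : ContDiff ℝ 1 B := by simp only [hB]; fun_prop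
  have hv1 : ContDiff ℝ 1 v := hv.of_le (by norm_num)
  have hv' : ContDiff ℝ 1 (deriv v) := by
    rw [show (2 : WithTop ℕ∞) = 1 + 1 by norm_num, contDiff_succ_iff_deriv] at hv
    exact hv.2.2
  have hmC : ContDiff ℝ 1 m :=
    (contDiff_snd.fst.smul (hv1.comp contDiff_fst)).sub (hv'.comp contDiff_fst)
  have hS : ∀ x, A x ^ 2 + B x ^ 2 = 4 * π ^ 2 + x.2.1 ^ 2 := fun x => by
    have := Real.sin_sq_add_cos_sq (2 * π * x.1)
    simp only [hA, hB]
    linear_combination (4 * π ^ 2 + x.2.1 ^ 2) * this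
  have hS0 : ∀ x, A x ^ 2 + B x ^ 2 ≠ 0 := fun x => by
    rw [hS]; positivity
  set F : ℝ × ℝ × E3 → E3 × E3 := fun x =>
    ((A x ^ 2 + B x ^ 2)⁻¹ • (A x • m x) - B x • x.2.2,
      (A x ^ 2 + B x ^ 2)⁻¹ • (B x • m x) + A x • x.2.2) with hF
  have hSC : ContDiff ℝ 1 fun x => (A x ^ 2 + B x ^ 2)⁻¹ :=
    ((hAC.pow 2).add (hBC.pow 2)).inv hS0
  have hFC : ContDiff ℝ 1 F :=
    ((hSC.smul (hAC.smul hmC)).sub (hBC.smul contDiff_snd.snd)).prodMk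
      ((hSC.smul (hBC.smul hmC)).add (hAC.smul contDiff_snd.snd))
  have hdense := hFC.dense_compl_range_of_finrank_lt_finrank (by simp)
  obtain ⟨⟨p, q⟩, hpq, hball⟩ := hdense.exists_mem_open (isOpen_ball (x := (0 : E3 × E3)) (ε := ε))
    ⟨0, mem_ball_self hε⟩
  rw [mem_ball_zero_iff] at hball
  refine ⟨p, q, (norm_fst_le (p, q)).trans hball.le, (norm_snd_le (p, q)).trans hball.le,
    fun t c hc => hpq ?_⟩
  have hθ : HasDerivAt (fun t : ℝ => 2 * π * t) (2 * π) t := by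
    simpa using (hasDerivAt_id t).const_mul (2 * π)
  have hd := ((hv1.differentiable one_ne_zero t).hasDerivAt.add
    ((hθ.cos.smul_const p).add (hθ.sin.smul_const q))).deriv
  have hc' := hd.symm.trans hc
  set z := (A (t, c, 0) ^ 2 + B (t, c, 0) ^ 2)⁻¹ • (A (t, c, 0) • q - B (t, c, 0) • p) with hz
  have hAz : A (t, c, z) = A (t, c, 0) := rfl
  have hBz : B (t, c, z) = B (t, c, 0) := rfl
  have hmz : m (t, c, z) = A (t, c, 0) • p + B (t, c, 0) • q := by
    simp only [hm, hA, hB]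
    rw [sub_eq_iff_eq_add, ← sub_eq_zero]
    rw [← sub_eq_zero] at hc'
    rw [← neg_eq_zero, ← hc']
    module
  refine ⟨(t, c, z), Prod.ext ?_ ?_⟩
  · change (A (t, c, z) ^ 2 + B (t, c, z) ^ 2)⁻¹ • (A (t, c, z) • m (t, c, z)) -
      B (t, c, z) • z = p
    rw [hAz, hBz, hmz, hz]
    have h0 := hS0 (t, c, 0)
    generalize A (t, c, 0) = a at h0 ⊢
    generalize B (t, c, 0) = b at h0 ⊢
    match_scalars <;> field_simp <;> ring
  · change (A (t, c, z) ^ 2 + B (t, c, z) ^ 2)⁻¹ • (B (t, c, z) • m (t, c, z)) +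
      A (t, c, z) • z = q
    rw [hAz, hBz, hmz, hz]
    have h0 := hS0 (t, c, 0)
    generalize A (t, c, 0) = a at h0 ⊢
    generalize B (t, c, 0) = b at h0 ⊢
    match_scalars <;> field_simp <;> ring

theorem sum_exp_roots_of_unity {n : ℕ} (hn : 2 ≤ n) :
    ∑ i ∈ Finset.range n, Complex.exp ((2 * π * (i / n : ℝ) : ℝ) * Complex.I) = 0 := by
  rw [← (Complex.isPrimitiveRoot_exp n (by omega)).geom_sum_eq_zero (by omega)]
  refine Finset.sum_congr rfl fun i _ => ?_
  rw [← Complex.exp_nat_mul]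
  congr 1; push_cast; ring

theorem sum_cos_roots_of_unity {n : ℕ} (hn : 2 ≤ n) :
    ∑ i ∈ Finset.range n, Real.cos (2 * π * (i / n)) = 0 := by
  have := congrArg Complex.re (sum_exp_roots_of_unity hn)
  simpa only [Complex.re_sum, Complex.exp_ofReal_mul_I_re, Complex.zero_re] using this

theorem sum_sin_roots_of_unity {n : ℕ} (hn : 2 ≤ n) :
    ∑ i ∈ Finset.range n, Real.sin (2 * π * (i / n)) = 0 := by
  have := congrArg Complex.im (sum_exp_roots_of_unity hn)
  simpa only [Complex.im_sum, Complex.exp_ofReal_mul_I_im, Complex.zero_im] using this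

theorem exists_regular_tangent_approx {γ : ℝ → E3} (hper : ∀ s, γ (s + 1) = γ s)
    (hC : ContDiff ℝ 1 γ) {ε : ℝ} (hε : 0 < ε) :
    ∃ (n : ℕ) (v : ℝ → E3), 2 ≤ n ∧ ContDiff ℝ 1 v ∧ (∀ s, v (s + 1) = v s) ∧
      (∀ t c : ℝ, deriv v t ≠ c • v t) ∧ ∑ i ∈ Finset.range n, v (i / n) = 0 ∧
      ∀ s t : ℝ, |s - t| ≤ 1 / n → ‖v s - deriv γ t‖ ≤ ε := by
  obtain ⟨n, v, hn, hv, hvp, hvs, hva⟩ := exists_smooth_tangent_approx hper hC (half_pos hε)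
  obtain ⟨p, q, hp, hq, hpq⟩ := exists_generic_perturbation hv (by positivity : 0 < ε / 4)
  refine ⟨n, _, hn, ?_, fun s => ?_, hpq, ?_, fun s t hst => ?_⟩
  · exact (hv.of_le (by norm_num)).add (by fun_prop)
  · simp only [hvp, mul_add, mul_one, Real.cos_add_two_pi, Real.sin_add_two_pi]
  · rw [Finset.sum_add_distrib, hvs, Finset.sum_add_distrib, ← Finset.sum_smul,
      ← Finset.sum_smul, sum_cos_roots_of_unity hn, sum_sin_roots_of_unity hn]
    simp
  · have h1 : ‖Real.cos (2 * π * s) • p‖ ≤ ε / 4 := by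
      rw [norm_smul]
      exact (mul_le_of_le_one_left (norm_nonneg _) (Real.abs_cos_le_one _)).trans hp
    have h2 : ‖Real.sin (2 * π * s) • q‖ ≤ ε / 4 := by
      rw [norm_smul]
      exact (mul_le_of_le_one_left (norm_nonneg _) (Real.abs_sin_le_one _)).trans hq
    rw [add_sub_right_comm]
    refine (norm_add_le _ _).trans ?_
    linarith [hva s t hst, norm_add_le (Real.cos (2 * π * s) • p) (Real.sin (2 * π * s) • q)]

theorem IsUnitSpeedSpherical.inner_eq_zero {T N : ℝ → E3} (hT : IsUnitSpeedSpherical T N) (s : ℝ) :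
    inner ℝ (T s) (N s) = 0 := by
  have h1 := (hT.hasDerivAt s).norm_sq
  have h2 : (fun s => ‖T s‖ ^ 2) = fun _ => (1 : ℝ) := funext fun s => by rw [hT.norm_eq]; norm_num
  have h3 := h1.unique (h2 ▸ hasDerivAt_const s (1 : ℝ))
  linarith

theorem norm_normalize_sub_normalize_le {a b : E3} (ha : a ≠ 0) (hb : b ≠ 0) :
    ‖‖a‖⁻¹ • a - ‖b‖⁻¹ • b‖ ≤ 2 * ‖a - b‖ / ‖b‖ := by
  have ha' : 0 < ‖a‖ := norm_pos_iff.2 ha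
  have hb' : 0 < ‖b‖ := norm_pos_iff.2 hb
  have e : ‖a‖⁻¹ • a - ‖b‖⁻¹ • b = ‖b‖⁻¹ • ((‖b‖ - ‖a‖) • (‖a‖⁻¹ • a) + (a - b)) := by
    match_scalars <;> field_simp; ring
  rw [e, norm_smul, norm_inv, norm_norm, inv_mul_eq_div]
  gcongr
  refine (norm_add_le _ _).trans ?_
  rw [norm_smul, norm_smul, norm_inv, norm_norm, inv_mul_cancel₀ ha'.ne', mul_one, norm_sub_rev a b,
    two_mul]
  gcongr
  exact abs_norm_sub_norm_le b a

theorem exists_norm_deriv_bounds {γ : ℝ → E3} (hper : ∀ s, γ (s + 1) = γ s)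
    (hC : ContDiff ℝ 1 γ) (hreg : ∀ s, deriv γ s ≠ 0) :
    ∃ m M : ℝ, 0 < m ∧ (∀ t, m ≤ ‖deriv γ t‖) ∧ ∀ t, ‖deriv γ t‖ ≤ M := by
  have hγc : Continuous fun t => ‖deriv γ t‖ := (hC.continuous_deriv le_rfl).norm
  obtain ⟨tm, -, htm⟩ := isCompact_Icc.exists_isMinOn (nonempty_Icc.2 zero_le_one)
    (hγc.continuousOn (s := Icc (0 : ℝ) 1))
  obtain ⟨tM, -, htM⟩ := isCompact_Icc.exists_isMaxOn (nonempty_Icc.2 zero_le_one)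
    (hγc.continuousOn (s := Icc (0 : ℝ) 1))
  have hmem : ∀ t : ℝ, Int.fract t ∈ Icc (0 : ℝ) 1 := fun t =>
    ⟨Int.fract_nonneg t, (Int.fract_lt_one t).le⟩
  have hfr : ∀ t : ℝ, deriv γ (Int.fract t) = deriv γ t := fun t => by
    have := (show Function.Periodic (deriv γ) 1 from deriv_add_period hper).sub_int_mul_eq
      (x := t) ⌊t⌋
    rwa [mul_one] at this
  exact ⟨‖deriv γ tm‖, ‖deriv γ tM‖, norm_pos_iff.2 (hreg tm), fun t => hfr t ▸ htm (hmem t),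
    fun t => hfr t ▸ htM (hmem t)⟩

/-- Inserting a small loop at the start of a short arc of `T` adjusts its displacement so that
it follows the piece of `γ` over `[a, b]`, whose velocity is close to `v`. -/
theorem IsUnitSpeedSpherical.shadows_loop {T N : ℝ → E3} (hT : IsUnitSpeedSpherical T N)
    {γ : ℝ → E3} {K ε ε₀ δ a b c p q : ℝ} {v : E3} (hK : 0 < K) (hab : a < b) (hpq : p ≤ q)
    (hc : 0 < c) (hδ : 0 < δ) (hε₀ : 0 < ε₀) (hv : ‖v‖ • T p = v)
    (hT' : ∀ s ∈ Icc p q, ‖T s - T p‖ ≤ δ)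
    (hlen : |c + (q - p) - K * (b - a) * ‖v‖| ≤ K * (b - a) * (ε₀ / 2))
    (hγ : ∀ s t, a ≤ s → s ≤ t → t ≤ b → ‖γ t - γ s - (t - s) • v‖ ≤ ε₀ * (t - s))
    (hε : δ * (‖v‖ + ε₀) + 2 * ε₀ ≤ ε) :
    Shadows γ K ε a b (T p) (N p) (T q) (N q) (c • T p + ∫ u in p..q, T u) := by
  have hba : 0 < b - a := sub_pos.2 hab
  set ρ := min δ (K * (b - a) * (ε₀ / 2) / c) with hρ
  have hρ0 : 0 < ρ := by positivity
  have hcρ : c * ρ ≤ K * (b - a) * (ε₀ / 2) := by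
    have := min_le_right δ (K * (b - a) * (ε₀ / 2) / c)
    rw [← hρ, le_div_iff₀ hc] at this
    linarith
  obtain ⟨l, C, B, hl1, hl2, hC, hC0, hB0, hCl, hBl, hCi, hCρ⟩ :=
    exists_loop (hT.norm_eq p) (hT.norm_velocity p) (hT.inner_eq_zero p) hc hρ0
  obtain ⟨G, M, hG, hGl, hGr⟩ := hC.exists_glue (hT.comp_add_const p) (l := l)
    (by simpa using hCl) (by simpa using hBl)
  have hl0 : 0 < l := hc.trans_le hl1
  have hG0 : G 0 = T p := by rw [(hGl 0 hl0.le).1, hC0]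
  have hM0 : M 0 = N p := by rw [(hGl 0 hl0.le).2, hB0]
  have hG1 : G (l + (q - p)) = T q := by
    rw [(hGr _ (by linarith)).1]; simp
  have hM1 : M (l + (q - p)) = N q := by
    rw [(hGr _ (by linarith)).2]; simp
  have hI : ∫ u in (0 : ℝ)..(l + (q - p)), G u = c • T p + ∫ u in p..q, T u := by
    rw [← intervalIntegral.integral_add_adjacent_intervals (hG.intervalIntegrable 0 l)
      (hG.intervalIntegrable l _), integral_eq_of_eqOn_Iic (fun s hs => (hGl s hs).1) hl0.le le_rfl,
      hCi, integral_eq_of_eqOn_Ici (A := fun s => T (s + p)) (fun s hs => (hGr s hs).1) le_rfl (by linarith),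
      intervalIntegral.integral_comp_add_right]
    simp
  have habs := abs_le.1 hlen
  have hdiff : |(l + (q - p)) / (b - a) - K * ‖v‖| ≤ K * ε₀ := by
    rw [div_sub' hba.ne', abs_div, abs_of_pos hba, div_le_iff₀ hba, abs_le]
    constructor <;> nlinarith
  suffices h : Shadows γ K ε a b (G 0) (M 0) (G (l + (q - p))) (M (l + (q - p)))
      (∫ u in (0 : ℝ)..(l + (q - p)), G u) by rwa [hG0, hM0, hG1, hM1, hI] at h
  refine hG.shadows (y := T p) (v := v) (ε₁ := ε₀) (ε₂ := ε₀) (δ := δ) hK.le hab (by linarith)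
    (fun s hs => ?_) ?_ hγ ?_
  · rcases le_total s l with h | h
    · rw [(hGl s h).1]
      exact (hCρ s).trans (min_le_left _ _)
    · rw [(hGr s h).1]
      exact hT' _ ⟨by linarith, by linarith [hs.2]⟩
  · rw [show K • v = (K * ‖v‖) • T p by rw [mul_smul, hv], ← sub_smul, norm_smul, hT.norm_eq, mul_one]
    exact hdiff
  · have h1 : (l + (q - p)) / (b - a) ≤ K * (‖v‖ + ε₀) := by linarith [(abs_le.1 hdiff).2]
    have h2 := mul_le_mul_of_nonneg_left h1 hδ.le
    nlinarith

/-- A closed unit-speed spherical curve whose integral follows `γ`, when the tangents of `γ`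
span `ℝ³`. -/
theorem exists_shadows_of_linearIndependent {γ : ℝ → E3} (hper : ∀ s, γ (s + 1) = γ s)
    (hC : ContDiff ℝ 1 γ) (hreg : ∀ s, deriv γ s ≠ 0) {τ : Fin 3 → ℝ} (hτ : ∀ j, τ j ∈ Ico 0 1)
    (hli : LinearIndependent ℝ fun j => deriv γ (τ j)) {ε : ℝ} (hε : 0 < ε) :
    ∃ K > 0, ∃ x w : E3, Shadows γ K ε 0 1 x w x w 0 := by
  have hγd : ∀ t, HasDerivAt γ (deriv γ t) t := fun t =>
    (hC.differentiable one_ne_zero t).hasDerivAt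
  obtain ⟨m, M, hm0, hmle, hleM⟩ := exists_norm_deriv_bounds hper hC hreg
  have hM0 : 0 ≤ M := (norm_nonneg _).trans (hleM 0)
  obtain ⟨ρ, hρ, hρli⟩ := Metric.isOpen_iff.1
    (isOpen_setOfPred_linearIndependent (𝕜 := ℝ) (E := E3) (ι := Fin 3)) _ hli
  set ε₀ := min (min (m / 2) 1) (min (ρ / 2) (ε / (8 / m * (M + 2) + 2))) with hε₀
  have hε₀0 : 0 < ε₀ := by positivity
  have hε₀m : ε₀ ≤ m / 2 := (min_le_left _ _).trans (min_le_left _ _)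
  have hε₀1 : ε₀ ≤ 1 := (min_le_left _ _).trans (min_le_right _ _)
  have hε₀ρ : ε₀ ≤ ρ / 2 := (min_le_right _ _).trans (min_le_left _ _)
  have hε₀ε : ε₀ * (8 / m * (M + 2) + 2) ≤ ε := by
    rw [← le_div_iff₀ (by positivity)]
    exact (min_le_right _ _).trans (min_le_right _ _)
  obtain ⟨n, v, hn, hvC, hvp, hvr, hvs, hva⟩ := exists_regular_tangent_approx hper hC hε₀0
  have hn0 : (0 : ℝ) < n := by exact_mod_cast (by omega : 0 < n)
  have hself : ∀ t, ‖v t - deriv γ t‖ ≤ ε₀ := fun t => hva t t (by simp)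
  have hvm : ∀ t, m / 2 ≤ ‖v t‖ := fun t => by
    have := norm_sub_norm_le (deriv γ t) (v t)
    rw [norm_sub_rev] at this
    linarith [hself t, hmle t]
  have hvM : ∀ t, ‖v t‖ ≤ M + 1 := fun t => by
    linarith [hself t, hleM t, norm_sub_norm_le (v t) (deriv γ t)]
  have hv0 : ∀ t, v t ≠ 0 := fun t => norm_pos_iff.1 ((half_pos hm0).trans_le (hvm t))
  have hspan : Submodule.span ℝ ((fun i : ℕ => v (i / n)) '' (Finset.range n : Set ℕ)) = ⊤ := by
    have hfl : ∀ j, ⌊n * τ j⌋₊ < n ∧ |(⌊n * τ j⌋₊ : ℝ) / n - τ j| ≤ 1 / n := fun j => by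
      have h0 : 0 ≤ n * τ j := mul_nonneg hn0.le (hτ j).1
      have h1 := Nat.floor_le h0
      have h2 := Nat.lt_floor_add_one (n * τ j)
      refine ⟨(Nat.floor_lt h0).2 (by nlinarith [(hτ j).2]), ?_⟩
      rw [div_sub' hn0.ne', abs_div, abs_of_pos hn0]
      gcongr
      rw [abs_le]
      constructor <;> linarith
    have h3 : LinearIndependent ℝ fun j => v ((⌊n * τ j⌋₊ : ℝ) / n) := by
      refine hρli ?_
      rw [mem_ball, dist_pi_lt_iff hρ]
      intro j
      rw [dist_eq_norm]
      linarith [hva _ _ (hfl j).2]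
    rw [eq_top_iff, ← h3.span_eq_top_of_card_eq_finrank (by simp)]
    refine Submodule.span_mono ?_
    rintro _ ⟨j, rfl⟩
    exact ⟨⌊n * τ j⌋₊, by simpa using (hfl j).1, rfl⟩
  obtain ⟨T, N, σ, hT, hσ, hσc, hσ0, hTσ, hT1, hN1⟩ := exists_unitSpeed_direction hvC hvp hv0 hvr
  obtain ⟨d, hd⟩ := (Submodule.mem_span_image_finset_iff_exists_fun' ℝ).1
    (hspan.ge (Submodule.mem_top (x := ∫ u in (0 : ℝ)..(σ 1), T u)))
  set p : ℕ → ℝ := fun i => σ (i / n) with hp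
  have hlarge : ∀ᶠ K : ℝ in Filter.atTop, 0 < K ∧ ∀ i ∈ Finset.range n,
      d i < K * (1 / n) ∧ |p (i + 1) - p i - ‖v (i / n)‖ * d i| ≤ K * (1 / n * (ε₀ / 2)) := by
    refine (Filter.eventually_gt_atTop 0).and ((Finset.eventually_all _).2 fun i _ => ?_)
    exact ((Filter.tendsto_id.atTop_mul_const (by positivity)).eventually_gt_atTop _).and
      ((Filter.tendsto_id.atTop_mul_const (by positivity)).eventually_ge_atTop _)
  obtain ⟨K, hK, hKi⟩ := hlarge.exists
  refine ⟨K, hK, T 0, N 0, ?_⟩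
  have hmono : Monotone fun i : ℕ => (i : ℝ) / n := fun i j hij => by
    simp only; gcongr
  have hseg : ∀ i < n, Shadows γ K ε ((i : ℝ) / n) (((i + 1 : ℕ) : ℝ) / n) (T (p i)) (N (p i))
      (T (p (i + 1))) (N (p (i + 1)))
      ((‖v (i / n)‖ * (K * (1 / n) - d i)) • T (p i) + ∫ u in (p i)..(p (i + 1)), T u) := by
    intro i hi
    obtain ⟨h1, h2⟩ := hKi i (Finset.mem_range.2 hi)
    have hlt : (i : ℝ) / n < ((i + 1 : ℕ) : ℝ) / n := by
      gcongr; exact_mod_cast Nat.lt_succ_self i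
    have hstep : ((i + 1 : ℕ) : ℝ) / n - (i : ℝ) / n = 1 / n := by push_cast; ring
    have hvpos : 0 < ‖v (i / n)‖ := norm_pos_iff.2 (hv0 _)
    refine hT.shadows_loop (v := v (i / n)) (ε₀ := ε₀) (δ := 8 * ε₀ / m) hK hlt
      (hσ.monotone hlt.le) (mul_pos hvpos (by linarith)) (by positivity) hε₀0 ?_ ?_ ?_ ?_ ?_
    · simp only [hp, hTσ]
      rw [smul_smul, mul_inv_cancel₀ hvpos.ne', one_smul]
    · intro s hs
      obtain ⟨t, ht, rfl⟩ := intermediate_value_Icc hlt.le hσc.continuousOn hs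
      simp only [hp, hTσ]
      refine (norm_normalize_sub_normalize_le (hv0 _) (hv0 _)).trans ?_
      have h3 : ‖v t - v (i / n)‖ ≤ 2 * ε₀ := by
        have h4 := hva t (i / n) (by
          rw [abs_of_nonneg (by linarith [ht.1])]; linarith [ht.2])
        have h5 := norm_sub_le_norm_sub_add_norm_sub (v t) (deriv γ (i / n)) (v (i / n))
        rw [norm_sub_rev (deriv γ _)] at h5
        linarith [hself (i / n)]
      calc 2 * ‖v t - v (i / n)‖ / ‖v (i / n)‖ ≤ 2 * (2 * ε₀) / (m / 2) := by
            gcongr; exact hvm _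
        _ = 8 * ε₀ / m := by field_simp; ring
    · rw [hstep]
      convert h2 using 1
      · congr 1; ring
      · ring
    · intro s t hs hst ht
      refine norm_image_sub_sub_smul_le hγd hst fun x hx => ?_
      rw [norm_sub_rev]
      refine hva _ _ ?_
      rw [abs_sub_comm, abs_of_nonneg (by linarith [hx.1])]
      linarith [hx.2]
    · have : 8 * ε₀ / m * (‖v (i / n)‖ + ε₀) ≤ 8 * ε₀ / m * (M + 2) := by
        refine mul_le_mul_of_nonneg_left ?_ (by positivity)
        linarith [hvM (i / n)]
      refine le_trans ?_ hε₀ε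
      calc _ ≤ 8 * ε₀ / m * (M + 2) + 2 * ε₀ := by linarith
        _ = _ := by ring
  obtain ⟨k, rfl⟩ : ∃ k, n = k + 1 := ⟨n - 1, by omega⟩
  have hp0 : p 0 = 0 := by simp [hp, hσ0]
  have hp1 : p (k + 1) = σ 1 := by
    simp only [hp]; rw [div_self hn0.ne']
  have := Shadows.chain hmono k (x := fun i => T (p i)) (w := fun i => N (p i))
    (fun i hi => hseg i (by omega))
  simp only [hp0, hp1, hT1, hN1, div_self hn0.ne', Nat.cast_zero, zero_div] at this
  convert this using 1
  rw [Finset.sum_add_distrib, intervalIntegral.sum_integral_adjacent_intervals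
    (fun i _ => hT.intervalIntegrable _ _), hp0, hp1, ← hd, ← Finset.sum_add_distrib]
  rw [← smul_zero (K * (1 / ((k + 1 : ℕ) : ℝ))), ← hvs, Finset.smul_sum]
  refine Finset.sum_congr rfl fun i _ => ?_
  have hvpos : ‖v (i / ((k + 1 : ℕ) : ℝ))‖ ≠ 0 := norm_ne_zero_iff.2 (hv0 _)
  simp only [hp, hTσ]
  rw [smul_smul, mul_right_comm, mul_inv_cancel₀ hvpos, one_mul, ← add_smul, sub_add_cancel]

theorem exists_linearIndependent_add_smul (a : Fin 3 → E3) {b : Fin 3 → E3}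
    (hb : LinearIndependent ℝ b) {η : ℝ} (hη : 0 < η) :
    ∃ s ∈ Ioo 0 η, LinearIndependent ℝ fun j => a j + s • b j := by
  set B := basisOfLinearIndependentOfCardEqFinrank hb (by simp)
  set A : E3 →ₗ[ℝ] E3 := B.constr ℝ a with hA
  have hfin : {s : ℝ | Module.End.HasEigenvalue A (-s)}.Finite :=
    (Module.End.finite_hasEigenvalue A).preimage neg_injective.injOn
  obtain ⟨s, hs, hns⟩ := (Ioo_infinite hη).exists_notMem_finite hfin
  refine ⟨s, hs, ?_⟩
  have hj : ∀ j, A (b j) = a j := fun j => by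
    have := B.constr_basis ℝ a j
    rwa [coe_basisOfLinearIndependentOfCardEqFinrank] at this
  rw [Fintype.linearIndependent_iff] at hb ⊢
  intro c hc
  refine hb c (by_contra fun hx0 => hns
    (Module.End.hasEigenvalue_of_hasEigenvector ⟨Module.End.mem_eigenspace_iff.2 ?_, hx0⟩))
  rw [neg_smul, eq_neg_iff_add_eq_zero, map_sum, Finset.smul_sum, ← Finset.sum_add_distrib, ← hc]
  refine Finset.sum_congr rfl fun j _ => ?_
  rw [map_smul, hj, smul_add, smul_comm]

theorem Shadows.of_norm_sub_le {γ γ' : ℝ → E3} {K ε ε' a b : ℝ} {x w y z d : E3} (hK : 0 ≤ K)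
    (h : Shadows γ' K ε' a b x w y z d)
    (hγ : ∀ s t, s ≤ t → ‖(γ' t - γ' s) - (γ t - γ s)‖ ≤ (ε - ε') * (t - s)) :
    Shadows γ K ε a b x w y z d := by
  obtain ⟨l, T, N, φ, hl, hT, hx, hw, hy, hz, hφ, hm, ha, hb, hd, hc⟩ := h
  refine ⟨l, T, N, φ, hl, hT, hx, hw, hy, hz, hφ, hm, ha, hb, hd, fun s t has hst htb => ?_⟩
  have h1 := hc s t has hst htb
  have h2 := mul_le_mul_of_nonneg_left (hγ s t hst) hK
  have e : (∫ u in (φ s)..(φ t), T u) - K • (γ t - γ s) =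
      ((∫ u in (φ s)..(φ t), T u) - K • (γ' t - γ' s)) +
        K • ((γ' t - γ' s) - (γ t - γ s)) := by module
  rw [e]
  refine (norm_add_le _ _).trans ?_
  rw [norm_smul, Real.norm_of_nonneg hK]
  linarith

/-- A closed curve in `ℝ³` whose tangents span `ℝ³`. -/
theorem exists_closed_curve_tangents_linearIndependent :
    ∃ g g' : ℝ → E3, (∀ t, HasDerivAt g (g' t) t) ∧ Continuous g' ∧ (∀ t, g (t + 1) = g t) ∧
      (∃ C > 0, ∀ t, ‖g' t‖ ≤ C) ∧
      ∃ τ : Fin 3 → ℝ, (∀ j, τ j ∈ Ico 0 1) ∧ LinearIndependent ℝ fun j => g' (τ j) := by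
  set e : Fin 3 → E3 := fun i => EuclideanSpace.single i 1 with he
  have hen : ∀ i, ‖e i‖ = 1 := fun i => by simp [he]
  refine ⟨fun t => Real.sin (2 * π * t) • e 0 + Real.cos (2 * π * t) • e 1 +
      Real.sin (4 * π * t) • e 2,
    fun t => (Real.cos (2 * π * t) * (2 * π)) • e 0 + (-Real.sin (2 * π * t) * (2 * π)) • e 1 +
      (Real.cos (4 * π * t) * (4 * π)) • e 2, fun t => ?_, by fun_prop, fun t => ?_,
    ⟨8 * π, by positivity, fun t => ?_⟩, ![0, 1 / 4, 1 / 2], fun j => ?_, ?_⟩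
  · have h : ∀ c : ℝ, HasDerivAt (fun t : ℝ => c * t) c t := fun c => by
      simpa using (hasDerivAt_id t).const_mul c
    exact (((h _).sin.smul_const _).add ((h _).cos.smul_const _)).add ((h _).sin.smul_const _)
  · have h : 4 * π * (t + 1) = 4 * π * t + 2 * π + 2 * π := by ring
    simp only [h, mul_add (2 * π), mul_one, Real.sin_add_two_pi, Real.cos_add_two_pi]
  · refine (norm_add₃_le).trans ?_
    simp only [norm_smul, norm_mul, norm_neg, hen, mul_one, Real.norm_eq_abs]
    have h3 : |(2 : ℝ)| = 2 := by norm_num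
    have h4 : |(4 : ℝ)| = 4 := by norm_num
    have h5 : |π| = π := abs_of_pos pi_pos
    rw [h3, h4, h5]
    nlinarith [Real.abs_cos_le_one (2 * π * t), Real.abs_sin_le_one (2 * π * t),
      Real.abs_cos_le_one (4 * π * t), pi_pos]
  · fin_cases j <;> simp <;> norm_num
  · have h1 : 2 * π * (1 / 4) = π / 2 := by ring
    have h2 : 4 * π * (1 / 4) = π := by ring
    have h3 : 2 * π * (1 / 2) = π := by ring
    have h4 : 4 * π * (1 / 2) = 2 * π := by ring
    rw [Fintype.linearIndependent_iff]
    intro c hc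
    simp only [Fin.sum_univ_three, Matrix.cons_val_zero, Matrix.cons_val_one, Matrix.cons_val,
      h1, h2, h3, h4] at hc
    have c0 := congrArg (fun x : E3 => x 0) hc
    have c1 := congrArg (fun x : E3 => x 1) hc
    have c2 := congrArg (fun x : E3 => x 2) hc
    simp [he] at c0 c1 c2
    have h02 : c 0 = c 2 :=
      mul_right_cancel₀ (by positivity : 2 * π ≠ 0) (eq_of_sub_eq_zero c0)
    have h0 : c 0 = 0 := by
      rw [c1, ← h02] at c2
      exact (mul_eq_zero.1 (by linear_combination c2 : c 0 * (8 * π) = 0)).resolve_right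
        (by positivity)
    intro j
    fin_cases j
    exacts [h0, c1, h02 ▸ h0]

/-- The tangent indicatrix of a closed space curve can be replaced by a closed unit-speed spherical
curve with vanishing total integral, following `γ` at large scale `K`. -/
theorem exists_shadows {γ : ℝ → E3} (hper : ∀ s, γ (s + 1) = γ s)
    (hC : ContDiff ℝ 1 γ) (hreg : ∀ s, deriv γ s ≠ 0) {ε : ℝ} (hε : 0 < ε) :
    ∃ K > 0, ∃ x w : E3, Shadows γ K ε 0 1 x w x w 0 := by
  obtain ⟨g, g', hg, hgc, hgp, ⟨C, hC0, hgC⟩, τ, hτ, hli⟩ :=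
    exists_closed_curve_tangents_linearIndependent
  obtain ⟨m, M, hm0, hmle, -⟩ := exists_norm_deriv_bounds hper hC hreg
  obtain ⟨s, ⟨hs0, hs⟩, hsli⟩ := exists_linearIndependent_add_smul (fun j => deriv γ (τ j)) hli
    (by positivity : 0 < min (m / C) (ε / 2 / C))
  have hsm : s * C < m := (lt_div_iff₀ hC0).1 (hs.trans_le (min_le_left _ _))
  have hsε : s * C < ε / 2 := (lt_div_iff₀ hC0).1 (hs.trans_le (min_le_right _ _))
  have hgs : ∀ t, ‖s • g' t‖ ≤ s * C := fun t => by
    rw [norm_smul, Real.norm_of_nonneg hs0.le]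
    exact mul_le_mul_of_nonneg_left (hgC t) hs0.le
  have hd : ∀ t, HasDerivAt (fun t => γ t + s • g t) (deriv γ t + s • g' t) t := fun t =>
    (hC.differentiable one_ne_zero t).hasDerivAt.add ((hg t).const_smul s)
  have hgC1 : ContDiff ℝ 1 g := by
    rw [contDiff_one_iff_deriv, funext fun t => (hg t).deriv]
    exact ⟨fun t => (hg t).differentiableAt, hgc⟩
  obtain ⟨K, hK, x, w, h⟩ := exists_shadows_of_linearIndependent (γ := fun t => γ t + s • g t)
    (fun t => by simp only [hper, hgp]) (hC.add (hgC1.const_smul s))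
    (fun t h0 => by
      rw [(hd t).deriv, add_eq_zero_iff_eq_neg] at h0
      have := hmle t
      rw [h0, norm_neg] at this
      linarith [hgs t]) hτ (by simpa only [(hd _).deriv] using hsli) (half_pos hε)
  refine ⟨K, hK, x, w, h.of_norm_sub_le hK.le fun a b hab => ?_⟩
  have := norm_image_sub_sub_smul_le (fun t => (hg t).const_smul s) (c := 0) hab
    (ε := s * C) (fun t _ => by rw [sub_zero]; exact hgs t)
  rw [smul_zero, sub_zero] at this
  rw [show γ b + s • g b - (γ a + s • g a) - (γ b - γ a) = s • g b - s • g a by module]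
  exact this.trans (mul_le_mul_of_nonneg_right (by linarith) (by linarith))

/-- The chord-arc property of an embedded closed `C¹` curve. -/
theorem exists_chord_arc_bound {γ : ℝ → E3} (hper : ∀ s, γ (s + 1) = γ s)
    (hC : ContDiff ℝ 1 γ) (hreg : ∀ s, deriv γ s ≠ 0) (hinj : InjOn γ (Ico 0 1)) :
    ∃ c > 0, ∀ s t, 0 ≤ s → s ≤ t → t ≤ 1 → c * min (t - s) (1 - (t - s)) ≤ ‖γ t - γ s‖ := by
  obtain ⟨m, M, hm0, hmle, -⟩ := exists_norm_deriv_bounds hper hC hreg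
  obtain ⟨δ, hδ, hmod⟩ := exists_modulus_of_periodic (hC.continuous_deriv le_rfl)
    (deriv_add_period hper) (half_pos hm0)
  have hlocal : ∀ s t, s ≤ t → t ≤ s + δ → m / 2 * (t - s) ≤ ‖γ t - γ s‖ := by
    intro s t hst hts
    have h1 := norm_image_sub_sub_smul_le
      (fun t => (hC.differentiable one_ne_zero t).hasDerivAt) (c := deriv γ s) hst (ε := m / 2)
      fun x hx => hmod _ _ (by rw [abs_of_nonneg (by linarith [hx.1])]; linarith [hx.2])
    have h2 := norm_sub_norm_le ((t - s) • deriv γ s) (γ t - γ s)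
    rw [norm_sub_rev _ (γ t - γ s), norm_smul, Real.norm_of_nonneg (by linarith)] at h2
    nlinarith [hmle s]
  set S : Set (ℝ × ℝ) := (Icc 0 1 ×ˢ Icc 0 1) ∩
    ({p | p.1 + δ ≤ p.2} ∩ {p | p.2 ≤ p.1 + 1 - δ}) with hS
  have hSc : IsCompact S := (isCompact_Icc.prod isCompact_Icc).inter_right
    ((isClosed_le (by fun_prop) (by fun_prop)).inter (isClosed_le (by fun_prop) (by fun_prop)))
  have hpos : ∀ p ∈ S, 0 < ‖γ p.2 - γ p.1‖ := by
    rintro ⟨s, t⟩ ⟨⟨⟨hs0, -⟩, -, ht1⟩, h1, h2⟩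
    simp only [mem_ofPred_eq] at hs0 ht1 h1 h2 ⊢
    rw [norm_pos_iff, sub_ne_zero]
    intro heq
    rcases ht1.eq_or_lt with rfl | ht1
    · have h0 := hper 0
      rw [zero_add] at h0
      have := hinj ⟨le_rfl, zero_lt_one⟩ ⟨hs0, by linarith⟩ (h0.symm.trans heq)
      linarith
    · have := hinj ⟨by linarith, ht1⟩ ⟨hs0, by linarith⟩ heq
      linarith
  have hγ := hC.continuous
  obtain ⟨c, hc, hcS⟩ := hSc.exists_forall_le' (by fun_prop) hpos
  refine ⟨min (m / 2) c, by positivity, fun s t hs hst ht => ?_⟩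
  have hmin0 : 0 ≤ min (t - s) (1 - (t - s)) := le_min (by linarith) (by linarith)
  rcases le_or_gt t (s + δ) with h1 | h1
  · refine le_trans ?_ (hlocal s t hst h1)
    exact mul_le_mul (min_le_left _ _) (min_le_left _ _) hmin0 (by positivity)
  rcases le_or_gt t (s + 1 - δ) with h2 | h2
  · refine le_trans ?_ (hcS (s, t) ⟨⟨⟨hs, by linarith⟩, by linarith, ht⟩, h1.le, h2⟩)
    calc min (m / 2) c * min (t - s) (1 - (t - s)) ≤ c * 1 :=
          mul_le_mul (min_le_right _ _) ((min_le_left _ _).trans (by linarith)) hmin0 hc.le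
      _ = c := mul_one c
  · have h3 := hlocal t (s + 1) (by linarith) (by linarith)
    rw [hper, norm_sub_rev] at h3
    refine le_trans ?_ h3
    exact mul_le_mul (min_le_left _ _) ((min_le_right _ _).trans (by linarith)) hmin0
      (by positivity)

theorem exists_lipschitz_displacement {γ E : ℝ → E3} {k : ℝ} (hk : 0 ≤ k)
    (hkC : lipschitzExtensionConstant E3 * k ≤ 1 / 2)
    (hE : ∀ s ∈ Icc (0 : ℝ) 1, ∀ t ∈ Icc (0 : ℝ) 1, ‖E t - E s‖ ≤ k * ‖γ t - γ s‖) :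
    ∃ V : E3 → E3, (∀ x y, ‖V x - V y‖ ≤ 1 / 2 * ‖x - y‖) ∧ ∀ s ∈ Icc (0 : ℝ) 1, V (γ s) = E s := by
  set V₀ : E3 → E3 := fun x => E (Function.invFunOn γ (Icc 0 1) x) with hV₀
  have hV₀E : ∀ s ∈ Icc (0 : ℝ) 1, V₀ (γ s) = E s := fun s hs => by
    have hmem : γ s ∈ γ '' Icc 0 1 := mem_image_of_mem γ hs
    have := hE s hs _ (Function.invFunOn_mem hmem)
    rw [Function.invFunOn_eq hmem, sub_self, norm_zero, mul_zero, norm_le_zero_iff,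
      sub_eq_zero] at this
    exact this
  have hL : LipschitzOnWith k.toNNReal V₀ (γ '' Icc 0 1) := by
    refine LipschitzOnWith.of_dist_le_mul ?_
    rintro _ ⟨t, ht, rfl⟩ _ ⟨s, hs, rfl⟩
    rw [hV₀E t ht, hV₀E s hs, dist_eq_norm, dist_eq_norm, Real.coe_toNNReal k hk]
    exact hE s hs t ht
  obtain ⟨V, hV, hVV⟩ := hL.extend_finite_dimension
  refine ⟨V, fun x y => ?_, fun s hs => ?_⟩
  · have := hV.dist_le_mul x y
    rw [dist_eq_norm, dist_eq_norm, NNReal.coe_mul, Real.coe_toNNReal k hk] at this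
    exact this.trans (mul_le_mul_of_nonneg_right hkC (norm_nonneg _))
  · rw [← hVV (mem_image_of_mem γ hs), hV₀E s hs]

theorem exists_homeomorph_smul_add_smul {V : E3 → E3} (hV : ∀ x y, ‖V x - V y‖ ≤ 1 / 2 * ‖x - y‖)
    {t a : ℝ} (ht : t ∈ Icc (0 : ℝ) 1) (ha : a ≠ 0) :
    ∃ e : E3 ≃ₜ E3, ∀ x, a • (x + t • V x) = e x := by
  have happ : ApproximatesLinearOn (fun x => x + t • V x)
      ((ContinuousLinearEquiv.refl ℝ E3 : E3 ≃L[ℝ] E3) : E3 →L[ℝ] E3) univ (1 / 2) := by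
    intro x _ y _
    have e : x + t • V x - (y + t • V y) - (x - y) = t • (V x - V y) := by module
    change ‖x + t • V x - (y + t • V y) - (x - y)‖ ≤ _
    rw [e, norm_smul, Real.norm_of_nonneg ht.1]
    have h1 := mul_le_of_le_one_left (norm_nonneg (V x - V y)) ht.2
    simpa using h1.trans (hV x y)
  have hN : ‖((ContinuousLinearEquiv.refl ℝ E3).symm : E3 →L[ℝ] E3)‖₊ = 1 :=
    NNReal.eq (ContinuousLinearMap.norm_id (𝕜 := ℝ) (E := E3))
  refine ⟨(happ.toHomeomorph _ (Or.inr ?_)).trans (Homeomorph.smulOfNeZero a ha), fun x => rfl⟩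
  rw [hN, inv_one, ← NNReal.coe_lt_coe]
  norm_num

/-- every knot can be represented by a C² curve of constant curvature.
A knot is encoded as a C¹ embedding `γ : 𝕊¹ → ℝ³` with nowhere-vanishing derivative,
i.e. a `1`-periodic C¹ map `γ : ℝ → ℝ³` with `γ' ≠ 0` everywhere that is injective on
`[0, 1)`.  The conclusion produces an `L`-periodic C² map `r : ℝ → ℝ³` with
`‖r'‖ = ‖r''‖ = 1` everywhere, injective on `[0, L)`, together with an ambient isotopy
`H : ℝ³ × [0, 1] → ℝ³` (continuous, `H(·,0) = id`, each `H(·,t)` a homeomorphism)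
carrying the image of `γ` onto the image of `r`. -/
theorem knot_has_constant_curvature_representative (γ : ℝ → E3)
    (hper : ∀ s, γ (s + 1) = γ s)
    (hC : ContDiff ℝ 1 γ)
    (hreg : ∀ s, deriv γ s ≠ 0)
    (hinj : InjOn γ (Ico 0 1)) :
    ∃ (L : ℝ) (r : ℝ → E3) (H : E3 × ℝ → E3),
      0 < L ∧
      ContDiff ℝ 2 r ∧
      (∀ s, r (s + L) = r s) ∧
      (∀ s, ‖deriv r s‖ = 1) ∧
      (∀ s, ‖deriv (deriv r) s‖ = 1) ∧
      InjOn r (Ico 0 L) ∧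
      ContinuousOn H (univ ×ˢ Icc (0 : ℝ) 1) ∧
      (∀ x : E3, H (x, 0) = x) ∧
      (∀ t ∈ Icc (0 : ℝ) 1, ∃ e : E3 ≃ₜ E3, ∀ x : E3, H (x, t) = e x) ∧
      (fun x => H (x, 1)) '' range γ = range r := by
  obtain ⟨c, hc, hchord⟩ := exists_chord_arc_bound hper hC hreg hinj
  set Λ : ℝ := (lipschitzExtensionConstant E3 : ℝ) with hΛ
  have hΛ0 : 0 < Λ := lipschitzExtensionConstant_pos E3
  obtain ⟨K, hK, x, w, l, T₀, N₀, φ, hl, hT₀, hx, hw, hy, hz, hφ, hφm, hφ0, hφ1, hd, hclose⟩ :=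
    exists_shadows hper hC hreg (by positivity : 0 < c / (2 * Λ))
  obtain ⟨T, N, hT, hTp, hTT₀⟩ := hT₀.exists_periodic hl (hy.trans hx.symm) (hz.trans hw.symm)
  have hφmem : ∀ s ∈ Icc (0 : ℝ) 1, φ s ∈ Icc 0 l := fun s hs =>
    ⟨hφ0 ▸ hφm hs.1, hφ1 ▸ hφm hs.2⟩
  set r : ℝ → E3 := fun s => ∫ u in (0 : ℝ)..s, T u with hr
  have hrd : ∀ s, HasDerivAt r (T s) s := fun s =>
    (hT.continuous.integral_hasStrictDerivAt 0 s).hasDerivAt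
  have hrd' : deriv r = T := funext fun s => (hrd s).deriv
  have hTd' : deriv T = N := funext fun s => (hT.hasDerivAt s).deriv
  have hrsub : ∀ a b, r b - r a = ∫ u in a..b, T u := fun a b => by
    rw [sub_eq_iff_eq_add', hr]
    exact (intervalIntegral.integral_add_adjacent_intervals (hT.intervalIntegrable 0 a)
      (hT.intervalIntegrable a b)).symm
  have hrT₀ : ∀ s ∈ Icc 0 l, ∀ t ∈ Icc 0 l, r t - r s = ∫ u in s..t, T₀ u := fun s hs t ht => by
    rw [hrsub]
    exact intervalIntegral.integral_congr fun u hu => hTT₀ u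
      ⟨(le_min hs.1 ht.1).trans hu.1, hu.2.trans (max_le hs.2 ht.2)⟩
  have hr0 : r 0 = 0 := intervalIntegral.integral_same
  have hrl : r l = 0 := by
    have := hrT₀ 0 ⟨le_rfl, hl.le⟩ l ⟨hl.le, le_rfl⟩
    rwa [hr0, sub_zero, hd] at this
  have hrp : Function.Periodic r l := fun s => by
    rw [← sub_eq_zero, hrsub, Function.Periodic.intervalIntegral_add_eq hTp s 0, ← hrsub, zero_add,
      hr0, hrl, sub_zero]
  set E : ℝ → E3 := fun s => K⁻¹ • r (φ s) - γ s with hE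
  have hEst : ∀ s t, 0 ≤ s → s ≤ t → t ≤ 1 → ‖E t - E s‖ ≤ c / (2 * Λ) * (t - s) := by
    intro s t hs hst ht
    have h1 := hclose s t hs hst ht
    rw [← hrT₀ _ (hφmem s ⟨hs, hst.trans ht⟩) _ (hφmem t ⟨hs.trans hst, ht⟩)] at h1
    have e : E t - E s = K⁻¹ • ((r (φ t) - r (φ s)) - K • (γ t - γ s)) := by
      simp only [hE]
      match_scalars <;> field_simp
    rw [e, norm_smul, norm_inv, Real.norm_of_nonneg hK.le, inv_mul_le_iff₀ hK]
    linarith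
  have hγ01 : γ 1 = γ 0 := by simpa using hper 0
  have hE01 : E 1 = E 0 := by simp only [hE, hφ0, hφ1, hr0, hrl, hγ01]
  have hEchord : ∀ s t, 0 ≤ s → s ≤ t → t ≤ 1 → ‖E t - E s‖ ≤ 1 / (2 * Λ) * ‖γ t - γ s‖ := by
    intro s t hs hst ht
    have h1 : ‖E t - E s‖ ≤ c / (2 * Λ) * min (t - s) (1 - (t - s)) := by
      rw [mul_min_of_nonneg _ _ (by positivity)]
      refine le_min (hEst s t hs hst ht) ?_
      have h2 := norm_sub_le_norm_sub_add_norm_sub (E t) (E 1) (E s)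
      have h3 := hEst t 1 (hs.trans hst) ht le_rfl
      have h4 := hEst 0 s le_rfl hs (hst.trans ht)
      rw [norm_sub_rev] at h3
      rw [norm_sub_rev, ← hE01] at h4
      linarith
    refine h1.trans ?_
    calc c / (2 * Λ) * min (t - s) (1 - (t - s))
        = 1 / (2 * Λ) * (c * min (t - s) (1 - (t - s))) := by ring
      _ ≤ _ := mul_le_mul_of_nonneg_left (hchord s t hs hst ht) (by positivity)
  obtain ⟨V, hV, hVE⟩ := exists_lipschitz_displacement (γ := γ) (E := E) (k := 1 / (2 * Λ))
    (by positivity) (by rw [← hΛ]; exact le_of_eq (by field_simp)) (fun s hs t ht => by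
      rcases le_total s t with h | h
      · exact hEchord s t hs.1 h ht.2
      · rw [norm_sub_rev, norm_sub_rev (γ t)]
        exact hEchord t s ht.1 h hs.2)
  have hVc : Continuous V := by
    refine (LipschitzWith.of_dist_le_mul (K := 1 / 2) fun x y => ?_).continuous
    rw [dist_eq_norm, dist_eq_norm]
    simpa using hV x y
  have hhomeo : ∀ t ∈ Icc (0 : ℝ) 1,
      ∃ e : E3 ≃ₜ E3, ∀ x, ((1 - t) + t * K) • (x + t • V x) = e x := fun t ht =>
    exists_homeomorph_smul_add_smul hV ht (by
      rcases ht.1.eq_or_lt with rfl | h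
      · norm_num
      · have := mul_pos h hK
        linarith [ht.2])
  have hfinal : ∀ s ∈ Icc (0 : ℝ) 1,
      ((1 - 1) + 1 * K) • (γ s + (1 : ℝ) • V (γ s)) = r (φ s) := fun s hs => by
    rw [hVE s hs, sub_self, zero_add, one_mul, one_smul, add_sub_cancel, smul_inv_smul₀ hK.ne']
  have hsurj : ∀ a ∈ Icc 0 l, ∃ s ∈ Icc (0 : ℝ) 1, φ s = a := fun a ha =>
    intermediate_value_Icc zero_le_one hφ.continuousOn (hφ0.symm ▸ hφ1.symm ▸ ha)
  refine ⟨l, r, fun p => ((1 - p.2) + p.2 * K) • (p.1 + p.2 • V p.1), hl, ?_, hrp, fun s => ?_,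
    fun s => ?_, fun a ha b hb hab => ?_, ?_, fun x => by simp, hhomeo, ?_⟩
  · rw [show (2 : WithTop ℕ∞) = 1 + 1 by norm_num, contDiff_succ_iff_deriv, hrd',
      contDiff_one_iff_deriv, hTd']
    exact ⟨fun s => (hrd s).differentiableAt, by simp,
      fun s => (hT.hasDerivAt s).differentiableAt, hT.continuous_velocity⟩
  · rw [hrd', hT.norm_eq]
  · rw [hrd', hTd', hT.norm_velocity]
  · obtain ⟨s, hs, rfl⟩ := hsurj a (Ico_subset_Icc_self ha)
    obtain ⟨t, ht, rfl⟩ := hsurj b (Ico_subset_Icc_self hb)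
    have hlt : ∀ u ∈ Icc (0 : ℝ) 1, φ u < l → u ∈ Ico (0 : ℝ) 1 := fun u hu h =>
      ⟨hu.1, lt_of_le_of_ne hu.2 fun h1 => h.ne (h1 ▸ hφ1)⟩
    obtain ⟨e, he⟩ := hhomeo 1 ⟨zero_le_one, le_rfl⟩
    rw [← hfinal s hs, ← hfinal t ht, he, he] at hab
    rw [hinj (hlt s hs ha.2) (hlt t ht hb.2) (e.injective hab)]
  · exact Continuous.continuousOn (by fun_prop)
  · ext y
    constructor
    · rintro ⟨_, ⟨u, rfl⟩, rfl⟩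
      obtain ⟨s, hs, hus⟩ := Function.Periodic.exists_mem_Ico₀ hper zero_lt_one u
      simp only [hus]
      exact ⟨φ s, (hfinal s (Ico_subset_Icc_self hs)).symm⟩
    · rintro ⟨u, rfl⟩
      obtain ⟨a, ha, hua⟩ := hrp.exists_mem_Ico₀ hl u
      obtain ⟨s, hs, rfl⟩ := hsurj a (Ico_subset_Icc_self ha)
      exact ⟨γ s, mem_range_self s, (hfinal s hs).trans hua.symm⟩
end
end

section
/- Every link can be represented by C² curves of constant curvature: for every finite family γ₁, …, γₘ : 𝕊¹ → ℝ³ of C¹ embeddings with nowhere-vanishing derivatives and pairwise disjoint images, there exist L₁, …, Lₘ > 0, C² maps r₁, …, rₘ : ℝ → ℝ³ with rᵢ(s + Lᵢ) = rᵢ(s), ‖rᵢ'(s)‖ = 1 and ‖rᵢ''(s)‖ = 1 for all s, each rᵢ injective on [0, Lᵢ), with pairwise disjoint images, and a continuous map H : ℝ³ × [0,1] → ℝ³ such that H(·,0) is the identity, H(·,t) is a homeomorphism of ℝ³ for every t, and H(γᵢ(𝕊¹) × {1}) equals the image rᵢ(ℝ) for each i = 1, …, m. -/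
open Set Metric Real

noncomputable section

/-! ### Ambient isotopies from small Lipschitz displacements -/

/-- A contraction added to the identity of a Banach space gives a homeomorphism. -/
lemma exists_homeomorph_id_add {E : Type*} [NormedAddCommGroup E] [NormedSpace ℝ E]
    [CompleteSpace E] {V : E → E} {c : NNReal} (hV : LipschitzWith c V) (hc : c < 1) :
    ∃ e : E ≃ₜ E, ∀ x, e x = x + V x := by
  have happ : ApproximatesLinearOn (fun x => x + V x)
      ((ContinuousLinearEquiv.refl ℝ E : E ≃L[ℝ] E) : E →L[ℝ] E) univ c := by
    intro x _ y _
    have h := hV.dist_le_mul x y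
    rw [dist_eq_norm, dist_eq_norm] at h
    have e : x + V x - (y + V y) - (x - y) = V x - V y := by abel
    rw [← e] at h
    exact h
  have hlt : Subsingleton E ∨
      c < ‖((ContinuousLinearEquiv.refl ℝ E).symm : E →L[ℝ] E)‖₊⁻¹ := by
    rcases subsingleton_or_nontrivial E with h | h
    · exact Or.inl h
    · right
      have : ‖((ContinuousLinearEquiv.refl ℝ E).symm : E →L[ℝ] E)‖₊ = 1 := by
        simp [ContinuousLinearEquiv.refl_symm, ContinuousLinearEquiv.coe_refl]
      rw [this, inv_one]
      exact hc
  exact ⟨happ.toHomeomorph _ hlt, fun x => rfl⟩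

/-- A family of points can be moved by an ambient isotopy whenever its displacement is a
sufficiently small Lipschitz function of the position. -/
lemma exists_isotopy_of_small_displacement :
    ∃ κ : ℝ, 0 < κ ∧ ∀ {ι : Type} (x y : ι → E3),
      (∀ i j, ‖(y i - x i) - (y j - x j)‖ ≤ κ * ‖x i - x j‖) →
      ∃ G : E3 × ℝ → E3, Continuous G ∧ (∀ z, G (z, 0) = z) ∧
        (∀ t ∈ Icc (0 : ℝ) 1, ∃ e : E3 ≃ₜ E3, ∀ z, G (z, t) = e z) ∧
        ∀ i, G (x i, 1) = y i := by
  have hc := lipschitzExtensionConstant_pos E3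
  set c := lipschitzExtensionConstant E3
  refine ⟨((c⁻¹ / 2 : NNReal) : ℝ), by positivity, fun {ι} x y h => ?_⟩
  have hwd : ∀ i j, x i = x j → y i - x i = y j - x j := by
    intro i j hij
    have := h i j
    rw [hij, sub_self, norm_zero, mul_zero] at this
    rw [← sub_eq_zero, ← norm_le_zero_iff, hij]
    exact this
  classical
  let V₀ : E3 → E3 := fun z => if hz : ∃ i, x i = z then y hz.choose - x hz.choose else 0
  have hV₀ : ∀ i, V₀ (x i) = y i - x i := by
    intro i
    have hz : ∃ j, x j = x i := ⟨i, rfl⟩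
    simp only [V₀, dif_pos hz]
    exact hwd _ _ hz.choose_spec
  have hLip : LipschitzOnWith (c⁻¹ / 2) V₀ (range x) := by
    apply LipschitzOnWith.of_dist_le_mul
    rintro _ ⟨i, rfl⟩ _ ⟨j, rfl⟩
    rw [hV₀, hV₀, dist_eq_norm, dist_eq_norm]
    exact h i j
  obtain ⟨V, hV, hEq⟩ := hLip.extend_finite_dimension
  have hhalf : c * (c⁻¹ / 2) = 1 / 2 := by field_simp
  rw [hhalf] at hV
  have hVc := hV.continuous
  refine ⟨fun q => q.1 + q.2 • V q.1, by fun_prop, fun z => by simp, fun t ht => ?_,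
    fun i => ?_⟩
  · have htV : LipschitzWith (1 / 2) (fun z => t • V z) := by
      apply LipschitzWith.of_dist_le_mul
      intro z z'
      have := hV.dist_le_mul z z'
      rw [dist_eq_norm] at this ⊢
      rw [← smul_sub, norm_smul, Real.norm_of_nonneg ht.1]
      calc t * ‖V z - V z'‖ ≤ 1 * ‖V z - V z'‖ := by gcongr; exact ht.2
        _ ≤ _ := by rw [one_mul]; exact this
    obtain ⟨e, he⟩ := exists_homeomorph_id_add htV
      (by rw [← NNReal.coe_lt_coe]; norm_num)
    exact ⟨e, fun z => (he z).symm⟩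
  · simp only [one_smul]
    rw [← hEq ⟨i, rfl⟩, hV₀]
    abel

/-! ### Chord-arc estimates for links -/

/-- The family `D` of closed curves is bounded by `ε` and Lipschitz with constant `ε`. -/
def SmallDisplacement {m : ℕ} (D : Fin m → ℝ → E3) (ε : ℝ) : Prop :=
  (∀ i s, D i (s + 1) = D i s) ∧ (∀ i s, ‖D i s‖ ≤ ε) ∧
    ∀ i s t, ‖D i s - D i t‖ ≤ ε * |s - t|

lemma periodic_apply_fract {X : Type*} {f : ℝ → X} (hf : Function.Periodic f 1) (u : ℝ) :
    f (Int.fract u) = f u := by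
  have := hf.sub_int_mul_eq (x := u) ⌊u⌋
  rwa [mul_one] at this

lemma exists_int_eq_add_of_eq {f : ℝ → E3} (hper : Function.Periodic f 1)
    (hinj : InjOn f (Ico 0 1)) {s t : ℝ} (h : f s = f t) : ∃ k : ℤ, s + k = t := by
  have hf : Int.fract t = Int.fract s :=
    hinj ⟨Int.fract_nonneg _, Int.fract_lt_one _⟩ ⟨Int.fract_nonneg _, Int.fract_lt_one _⟩
      (by rw [periodic_apply_fract hper, periodic_apply_fract hper, h])
  obtain ⟨k, hk⟩ := Int.fract_eq_fract.1 hf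
  exact ⟨k, by rw [← hk]; ring⟩

lemma eventually_displacement_le {m : ℕ} {γ : Fin m → ℝ → E3}
    (hper : ∀ i, ∀ s, γ i (s + 1) = γ i s)
    (hC : ∀ i, ContDiff ℝ 1 (γ i))
    (hreg : ∀ i, ∀ s, deriv (γ i) s ≠ 0)
    (hinj : ∀ i, InjOn (γ i) (Ico 0 1))
    (hdisj : ∀ i j, i ≠ j → Disjoint (range (γ i)) (range (γ j)))
    (i j : Fin m) (s₀ t₀ : ℝ) :
    ∃ C : ℝ, 0 ≤ C ∧ ∀ᶠ z : ℝ × ℝ in nhds (s₀, t₀), ∀ D ε, SmallDisplacement D ε →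
      ‖D i z.1 - D j z.2‖ ≤ C * ε * ‖γ i z.1 - γ j z.2‖ := by
  have hεnn : ∀ {D : Fin m → ℝ → E3} {ε}, SmallDisplacement D ε → 0 ≤ ε :=
    fun h => (norm_nonneg _).trans (h.2.1 i 0)
  by_cases hne : γ i s₀ = γ j t₀
  · have hij : i = j := by
      by_contra hij
      exact Set.disjoint_left.1 (hdisj i j hij) ⟨s₀, rfl⟩ ⟨t₀, hne.symm⟩
    subst hij
    obtain ⟨k, hk⟩ := exists_int_eq_add_of_eq (hper i) (hinj i) hne
    set v := deriv (γ i) t₀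
    have hv : 0 < ‖v‖ := norm_pos_iff.2 (hreg i t₀)
    have hstrict : HasStrictDerivAt (γ i) v t₀ :=
      (hC i).contDiffAt.hasStrictDerivAt one_ne_zero
    have hlo := hstrict.hasStrictFDerivAt.isLittleO.def (half_pos hv)
    have htend : Filter.Tendsto (fun z : ℝ × ℝ => (z.1 + (k : ℝ), z.2)) (nhds (s₀, t₀))
        (nhds (t₀, t₀)) := by
      have : Continuous (fun z : ℝ × ℝ => (z.1 + (k : ℝ), z.2)) := by fun_prop
      have h2 := this.tendsto (s₀, t₀)
      simpa only [hk] using h2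
    refine ⟨2 / ‖v‖, by positivity, ?_⟩
    filter_upwards [htend.eventually hlo] with z hz D ε hD
    have hp : ∀ f : ℝ → E3, Function.Periodic f 1 → f (z.1 + k) = f z.1 := fun f hf => by
      have := hf.int_mul k z.1
      rwa [mul_one] at this
    simp only [hp _ (hper i), ContinuousLinearMap.toSpanSingleton_apply] at hz
    rw [← hp _ (hD.1 i)]
    have h1 : ‖(z.1 + k - z.2) • v‖ ≤ ‖γ i z.1 - γ i z.2‖ + ‖v‖ / 2 * ‖z.1 + k - z.2‖ := by
      have := norm_sub_norm_le ((z.1 + k - z.2) • v) (γ i z.1 - γ i z.2)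
      rw [norm_sub_rev _ (γ i z.1 - γ i z.2)] at this
      linarith
    rw [norm_smul] at h1
    have h2 : |z.1 + k - z.2| ≤ 2 / ‖v‖ * ‖γ i z.1 - γ i z.2‖ := by
      rw [div_mul_eq_mul_div, le_div_iff₀ hv, ← Real.norm_eq_abs]
      linarith
    calc _ ≤ ε * |z.1 + k - z.2| := hD.2.2 i _ _
      _ ≤ ε * (2 / ‖v‖ * ‖γ i z.1 - γ i z.2‖) := by
          gcongr
          exact hεnn hD
      _ = _ := by ring
  · have hd : 0 < ‖γ i s₀ - γ j t₀‖ := norm_pos_iff.2 (sub_ne_zero.2 hne)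
    set d := ‖γ i s₀ - γ j t₀‖
    have hcont : Continuous (fun z : ℝ × ℝ => ‖γ i z.1 - γ j z.2‖) := by
      have := (hC i).continuous
      have := (hC j).continuous
      fun_prop
    refine ⟨4 / d, by positivity, ?_⟩
    filter_upwards [hcont.continuousAt.eventually (lt_mem_nhds (half_lt_self hd))]
      with z hz D ε hD
    have hε := hεnn hD
    calc _ ≤ ‖D i z.1‖ + ‖D j z.2‖ := norm_sub_le _ _
      _ ≤ ε + ε := add_le_add (hD.2.1 _ _) (hD.2.1 _ _)
      _ = 4 / d * ε * (d / 2) := by field_simp; ring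
      _ ≤ _ := by gcongr

lemma exists_displacement_le {m : ℕ} {γ : Fin m → ℝ → E3}
    (hper : ∀ i, ∀ s, γ i (s + 1) = γ i s)
    (hC : ∀ i, ContDiff ℝ 1 (γ i))
    (hreg : ∀ i, ∀ s, deriv (γ i) s ≠ 0)
    (hinj : ∀ i, InjOn (γ i) (Ico 0 1))
    (hdisj : ∀ i j, i ≠ j → Disjoint (range (γ i)) (range (γ j))) :
    ∃ C : ℝ, 0 ≤ C ∧ ∀ D ε, SmallDisplacement D ε → ∀ i j s t,
      ‖D i s - D j t‖ ≤ C * ε * ‖γ i s - γ j t‖ := by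
  have hpair : ∀ i j, ∃ C : ℝ, 0 ≤ C ∧ ∀ z ∈ Icc (0 : ℝ) 1 ×ˢ Icc (0 : ℝ) 1, ∀ D ε,
      SmallDisplacement D ε → ‖D i z.1 - D j z.2‖ ≤ C * ε * ‖γ i z.1 - γ j z.2‖ := by
    intro i j
    refine (isCompact_Icc.prod isCompact_Icc).induction_on
      (p := fun S => ∃ C : ℝ, 0 ≤ C ∧ ∀ z ∈ S, ∀ D ε,
        SmallDisplacement D ε → ‖D i z.1 - D j z.2‖ ≤ C * ε * ‖γ i z.1 - γ j z.2‖)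
      ⟨0, le_rfl, by simp⟩ ?_ ?_ ?_
    · rintro S T hST ⟨C, hC0, hT⟩
      exact ⟨C, hC0, fun z hz => hT z (hST hz)⟩
    · rintro S T ⟨C, hC0, hS⟩ ⟨C', hC0', hT⟩
      refine ⟨max C C', le_max_of_le_left hC0, fun z hz D ε hD => ?_⟩
      have hε : 0 ≤ ε := (norm_nonneg _).trans (hD.2.1 i 0)
      rcases hz with hz | hz
      · refine (hS z hz D ε hD).trans ?_
        gcongr
        exact le_max_left _ _
      · refine (hT z hz D ε hD).trans ?_
        gcongr
        exact le_max_right _ _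
    · rintro ⟨s₀, t₀⟩ -
      obtain ⟨C, hC0, h⟩ := eventually_displacement_le hper hC hreg hinj hdisj i j s₀ t₀
      exact ⟨_, mem_nhdsWithin_of_mem_nhds h, C, hC0, fun z hz => hz⟩
  choose C hC0 hCle using hpair
  refine ⟨∑ i, ∑ j, C i j, Finset.sum_nonneg fun i _ => Finset.sum_nonneg fun j _ => hC0 i j,
    fun D ε hD i j s t => ?_⟩
  have hε : 0 ≤ ε := (norm_nonneg _).trans (hD.2.1 i 0)
  have h := hCle i j (Int.fract s, Int.fract t)
    ⟨⟨Int.fract_nonneg _, (Int.fract_lt_one _).le⟩,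
      ⟨Int.fract_nonneg _, (Int.fract_lt_one _).le⟩⟩ D ε hD
  simp only [periodic_apply_fract (hper _), periodic_apply_fract (hD.1 _)] at h
  refine h.trans ?_
  gcongr
  calc C i j ≤ ∑ j, C i j :=
        Finset.single_le_sum (f := fun j => C i j) (fun j _ => hC0 i j) (Finset.mem_univ j)
    _ ≤ _ := Finset.single_le_sum (f := fun i => ∑ j, C i j)
        (fun i _ => Finset.sum_nonneg fun j _ => hC0 i j) (Finset.mem_univ i)

/-! ### Uniform estimates over compact sets -/

/-- If `f` is strictly differentiable along `{μ₀} × S` with `S` compact, then the difference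
`f (μ, ·) - f (μ₀, ·)` is small on `S`, with a small Lipschitz constant, for `μ` near `μ₀`. -/
lemma eventually_small_lipschitz_difference {P Y E : Type*} [NormedAddCommGroup P]
    [NormedSpace ℝ P] [NormedAddCommGroup Y] [NormedSpace ℝ Y] [NormedAddCommGroup E]
    [NormedSpace ℝ E] {f : P × Y → E} {μ₀ : P} {S : Set Y} (hS : IsCompact S)
    (hf : ∀ y ∈ S, ContDiffAt ℝ 1 f (μ₀, y)) {ε : ℝ} (hε : 0 < ε) :
    ∀ᶠ μ in nhds μ₀, ∀ y ∈ S, ‖f (μ, y) - f (μ₀, y)‖ ≤ ε ∧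
      ∀ y' ∈ S, ‖(f (μ, y) - f (μ₀, y)) - (f (μ, y') - f (μ₀, y'))‖ ≤ ε * ‖y - y'‖ := by
  have hbase : Continuous (fun z : P × Y => (μ₀, z.2)) := by fun_prop
  have hdiff : ∀ y ∈ S, Filter.Tendsto (fun z : P × Y => f (z.1, z.2) - f (μ₀, z.2))
      (nhds (μ₀, y)) (nhds 0) := by
    intro y hy
    have h1 : Filter.Tendsto (fun z : P × Y => f (z.1, z.2)) (nhds (μ₀, y)) (nhds (f (μ₀, y))) :=
      (hf y hy).continuousAt
    have h2 : Filter.Tendsto (fun z : P × Y => f (μ₀, z.2)) (nhds (μ₀, y)) (nhds (f (μ₀, y))) :=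
      (hf y hy).continuousAt.tendsto.comp (hbase.tendsto (μ₀, y))
    simpa using h1.sub h2
  have hsup : ∀ᶠ μ in nhds μ₀, ∀ y ∈ S, ‖f (μ, y) - f (μ₀, y)‖ ≤ ε := by
    refine hS.eventually_forall_of_forall_eventually fun y hy => ?_
    have := (hdiff y hy).norm
    rw [norm_zero] at this
    exact this.eventually (ge_mem_nhds hε)
  have hlip : ∀ᶠ μ in nhds μ₀, ∀ q ∈ S ×ˢ S,
      ‖(f (μ, q.1) - f (μ₀, q.1)) - (f (μ, q.2) - f (μ₀, q.2))‖ ≤ ε * ‖q.1 - q.2‖ := by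
    refine (hS.prod hS).eventually_forall_of_forall_eventually ?_
    rintro ⟨y, y'⟩ ⟨hy, hy'⟩
    by_cases hyy : y = y'
    · subst hyy
      have hlo := ((hf y hy).hasStrictFDerivAt one_ne_zero).isLittleO.def (half_pos hε)
      have c1 : Continuous (fun z : P × Y × Y => ((z.1, z.2.1), (z.1, z.2.2))) := by fun_prop
      have c2 : Continuous (fun z : P × Y × Y => ((μ₀, z.2.1), (μ₀, z.2.2))) := by fun_prop
      filter_upwards [(c1.tendsto (μ₀, y, y)).eventually hlo,
        (c2.tendsto (μ₀, y, y)).eventually hlo] with z h1 h2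
      simp only [Prod.mk_sub_mk, sub_self, Prod.norm_mk, norm_zero,
        max_eq_right (norm_nonneg _)] at h1 h2
      set A := fderiv ℝ f (μ₀, y) (0, z.2.1 - z.2.2)
      calc _ = ‖(f (z.1, z.2.1) - f (z.1, z.2.2) - A) -
              (f (μ₀, z.2.1) - f (μ₀, z.2.2) - A)‖ := by congr 1; abel
        _ ≤ _ := norm_sub_le _ _
        _ ≤ ε / 2 * ‖z.2.1 - z.2.2‖ + ε / 2 * ‖z.2.1 - z.2.2‖ := add_le_add h1 h2
        _ = _ := by ring
    · have c1 : Continuous (fun z : P × Y × Y => (z.1, z.2.1)) := by fun_prop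
      have c2 : Continuous (fun z : P × Y × Y => (z.1, z.2.2)) := by fun_prop
      have t1 := ((hdiff y hy).comp (c1.tendsto (μ₀, y, y'))).sub
        ((hdiff y' hy').comp (c2.tendsto (μ₀, y, y')))
      have t2 : Filter.Tendsto (fun z : P × Y × Y => ε * ‖z.2.1 - z.2.2‖) (nhds (μ₀, y, y'))
          (nhds (ε * ‖y - y'‖)) := by
        have : Continuous (fun z : P × Y × Y => ε * ‖z.2.1 - z.2.2‖) := by fun_prop
        exact this.tendsto (μ₀, y, y')
      have t1' := t1.norm
      rw [sub_zero, norm_zero] at t1'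
      have hpos : 0 < ε * ‖y - y'‖ := mul_pos hε (norm_pos_iff.2 (sub_ne_zero.2 hyy))
      filter_upwards [t1'.eventually_lt t2 hpos] with z hz
      exact hz.le
  filter_upwards [hsup, hlip] with μ h1 h2 y hy
  exact ⟨h1 y hy, fun y' hy' => h2 (y, y') ⟨hy, hy'⟩⟩

lemma periodic_deriv {f : ℝ → E3} {T : ℝ} (hf : Function.Periodic f T) :
    Function.Periodic (deriv f) T := by
  intro s
  rw [← deriv_comp_add_const]
  congr 1
  exact funext hf

/-- Velocity fields of closed curves of class `C¹` are approximated by the difference quotients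
of the curve, which are themselves of class `C¹` and have mean zero. -/
lemma exists_contDiff_velocity_approximation {γ : ℝ → E3} (hper : ∀ s, γ (s + 1) = γ s)
    (hC : ContDiff ℝ 1 γ) {ε : ℝ} (hε : 0 < ε) :
    ∃ w : ℝ → E3, ContDiff ℝ 1 w ∧ (∀ s, w (s + 1) = w s) ∧ (∫ s in (0 : ℝ)..1, w s) = 0 ∧
      ∀ s, ‖w s - deriv γ s‖ ≤ ε := by
  have hev : ∀ᶠ h in nhds (0 : ℝ), ∀ s ∈ Icc (0 : ℝ) 1,
      ‖γ (s + h) - γ s - h • deriv γ s‖ ≤ ε * |h| := by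
    refine isCompact_Icc.eventually_forall_of_forall_eventually fun s _ => ?_
    have hlo := (hC.contDiffAt.hasStrictDerivAt one_ne_zero :
      HasStrictDerivAt γ (deriv γ s) s).hasStrictFDerivAt.isLittleO.def (half_pos hε)
    have c1 : Continuous (fun z : ℝ × ℝ => (z.2 + z.1, z.2)) := by fun_prop
    have t1 := c1.tendsto (0, s)
    simp only [add_zero] at t1
    have c2 : Continuous (fun z : ℝ × ℝ => ‖deriv γ s - deriv γ z.2‖) := by
      have := hC.continuous_deriv le_rfl
      fun_prop
    have t2 := c2.tendsto (0, s)
    simp only [sub_self, norm_zero] at t2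
    filter_upwards [t1.eventually hlo, t2.eventually (ge_mem_nhds (half_pos hε))] with z h1 h2
    simp only [add_sub_cancel_left, ContinuousLinearMap.toSpanSingleton_apply,
      Real.norm_eq_abs] at h1
    calc _ = ‖(γ (z.2 + z.1) - γ z.2 - z.1 • deriv γ s) +
            z.1 • (deriv γ s - deriv γ z.2)‖ := by congr 1; rw [smul_sub]; abel
      _ ≤ ε / 2 * |z.1| + |z.1| * (ε / 2) := by
          refine (norm_add_le _ _).trans (add_le_add h1 ?_)
          rw [norm_smul, Real.norm_eq_abs]
          gcongr
      _ = _ := by ring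
  obtain ⟨r, hr, hball⟩ := Metric.eventually_nhds_iff.1 hev
  have hh : (r / 2) ≠ 0 := by positivity
  have hhr : dist (r / 2) 0 < r := by
    rw [Real.dist_eq, sub_zero, abs_of_pos (half_pos hr)]
    exact half_lt_self hr
  have hb := hball hhr
  generalize r / 2 = h at hh hb
  have hpd : ∀ s, ‖γ (s + h) - γ s - h • deriv γ s‖ ≤ ε * |h| := by
    intro s
    have hp : Function.Periodic (fun s => ‖γ (s + h) - γ s - h • deriv γ s‖) 1 := by
      intro s
      have e1 : γ (s + 1 + h) = γ (s + h) := by rw [add_right_comm, hper]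
      have e2 : deriv γ (s + 1) = deriv γ s := periodic_deriv hper s
      simp only [e1, e2, hper s]
    rw [← periodic_apply_fract hp s]
    exact hb _ ⟨Int.fract_nonneg _, (Int.fract_lt_one _).le⟩
  refine ⟨fun s => h⁻¹ • (γ (s + h) - γ s), by fun_prop, fun s => ?_, ?_, fun s => ?_⟩
  · simp only [add_right_comm s 1 h, hper]
  · have hcont := hC.continuous
    rw [intervalIntegral.integral_smul, intervalIntegral.integral_sub
      ((by fun_prop : Continuous fun s => γ (s + h)).intervalIntegrable _ _)
      (hcont.intervalIntegrable _ _), intervalIntegral.integral_comp_add_right]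
    have := Function.Periodic.intervalIntegral_add_eq hper h 0
    rw [zero_add] at this
    rw [zero_add, add_comm 1 h, this, sub_self, smul_zero]
  · have : h⁻¹ • (γ (s + h) - γ s) - deriv γ s =
        h⁻¹ • (γ (s + h) - γ s - h • deriv γ s) := by
      rw [smul_sub _ (γ (s + h) - γ s), inv_smul_smul₀ hh]
    rw [this, norm_smul, norm_inv, Real.norm_eq_abs, inv_mul_le_iff₀ (abs_pos.2 hh), mul_comm]
    exact hpd s

/-- The multiples of the values of a `C¹` curve do not fill `ℝ³`. -/
lemma exists_transverse_direction {w : ℝ → E3} (hw : ContDiff ℝ 1 w) :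
    ∃ a : E3, ∀ s c : ℝ, a ≠ c • w s := by
  have hC : ContDiff ℝ 1 (fun z : ℝ × ℝ => z.2 • w z.1) := by fun_prop
  have hd := hC.dense_compl_range_of_finrank_lt_finrank (by simp)
  obtain ⟨a, ha⟩ := hd.nonempty
  exact ⟨a, fun s c h => ha ⟨(s, c), h.symm⟩⟩

/-! ### Small loops on the unit sphere -/

/-- The cross product of `ℝ³`. -/
def crossE3 (x y : E3) : E3 :=
  !₂[x 1 * y 2 - x 2 * y 1, x 2 * y 0 - x 0 * y 2, x 0 * y 1 - x 1 * y 0]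

lemma inner_E3 (x y : E3) : inner ℝ x y = x 0 * y 0 + x 1 * y 1 + x 2 * y 2 := by
  simp [PiLp.inner_apply, Fin.sum_univ_three, mul_comm]

lemma inner_crossE3_left (x y : E3) : inner ℝ x (crossE3 x y) = 0 := by
  rw [inner_E3]
  simp [crossE3]
  ring

lemma inner_crossE3_right (x y : E3) : inner ℝ y (crossE3 x y) = 0 := by
  rw [inner_E3]
  simp [crossE3]
  ring

lemma norm_crossE3_sq (x y : E3) :
    ‖crossE3 x y‖ ^ 2 = ‖x‖ ^ 2 * ‖y‖ ^ 2 - inner ℝ x y ^ 2 := by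
  simp only [← real_inner_self_eq_norm_sq, inner_E3]
  simp [crossE3]
  ring

lemma ContDiffAt.crossE3 {E : Type*} [NormedAddCommGroup E] [NormedSpace ℝ E] {f g : E → E3}
    {z : E} {n : WithTop ℕ∞} (hf : ContDiffAt ℝ n f z) (hg : ContDiffAt ℝ n g z) :
    ContDiffAt ℝ n (fun y => crossE3 (f y) (g y)) z := by
  rw [contDiffAt_euclidean] at *
  intro i
  have hf0 := hf 0
  have hf1 := hf 1
  have hf2 := hf 2
  have hg0 := hg 0
  have hg1 := hg 1
  have hg2 := hg 2
  fin_cases i <;> simp only [_root_.crossE3] <;> simp <;> fun_prop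

lemma exists_smul_eq_of_crossE3_eq_zero {a x : E3} (hx : x ≠ 0) (h : crossE3 a x = 0) :
    ∃ c : ℝ, a = c • x := by
  have h0 := congrArg (fun v : E3 => v 0) h
  have h1 := congrArg (fun v : E3 => v 1) h
  have h2 := congrArg (fun v : E3 => v 2) h
  simp [crossE3] at h0 h1 h2
  have hx' : x 0 ≠ 0 ∨ x 1 ≠ 0 ∨ x 2 ≠ 0 := by
    by_contra! hc
    exact hx (by ext i; fin_cases i <;> simp [hc])
  rcases hx' with hk | hk | hk
  · refine ⟨a 0 / x 0, ?_⟩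
    ext i
    fin_cases i <;> simp <;> field_simp <;> linarith
  · refine ⟨a 1 / x 1, ?_⟩
    ext i
    fin_cases i <;> simp <;> field_simp <;> linarith
  · refine ⟨a 2 / x 2, ?_⟩
    ext i
    fin_cases i <;> simp <;> field_simp <;> linarith

/-- The unit vector orthogonal to `a` and `x`. -/
def frameFst (a x : E3) : E3 := ‖crossE3 a x‖⁻¹ • crossE3 a x

/-- The unit vector completing `x / ‖x‖` and `frameFst a x` to an orthonormal basis. -/
def frameSnd (a x : E3) : E3 := ‖x‖⁻¹ • crossE3 x (frameFst a x)

lemma ne_zero_of_crossE3_ne_zero {a x : E3} (h : crossE3 a x ≠ 0) : x ≠ 0 := by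
  rintro rfl
  exact h (by ext i; fin_cases i <;> simp [crossE3])

section Frame

variable {a x : E3}

lemma norm_frameFst (h : crossE3 a x ≠ 0) : ‖frameFst a x‖ = 1 := by
  rw [frameFst, norm_smul, norm_inv, norm_norm, inv_mul_cancel₀ (norm_ne_zero_iff.2 h)]

lemma inner_frameFst (a x : E3) : inner ℝ x (frameFst a x) = 0 := by
  rw [frameFst, inner_smul_right, inner_crossE3_right, mul_zero]

lemma inner_frameSnd (a x : E3) : inner ℝ x (frameSnd a x) = 0 := by
  rw [frameSnd, inner_smul_right, inner_crossE3_left, mul_zero]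

lemma inner_frameFst_frameSnd (a x : E3) : inner ℝ (frameFst a x) (frameSnd a x) = 0 := by
  rw [frameSnd, inner_smul_right, inner_crossE3_right, mul_zero]

lemma norm_frameSnd (h : crossE3 a x ≠ 0) : ‖frameSnd a x‖ = 1 := by
  have hx := norm_ne_zero_iff.2 (ne_zero_of_crossE3_ne_zero h)
  have hsq : ‖crossE3 x (frameFst a x)‖ ^ 2 = ‖x‖ ^ 2 := by
    rw [norm_crossE3_sq, inner_frameFst, norm_frameFst h]
    ring
  have := (sq_eq_sq₀ (norm_nonneg _) (norm_nonneg _)).1 hsq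
  rw [frameSnd, norm_smul, norm_inv, norm_norm, this, inv_mul_cancel₀ hx]

lemma norm_frame_combination_sq (h : crossE3 a x ≠ 0) (r c s : ℝ) :
    ‖r • x + (c • frameFst a x + s • frameSnd a x)‖ ^ 2 =
      r ^ 2 * ‖x‖ ^ 2 + c ^ 2 + s ^ 2 := by
  have h1 : inner ℝ (frameFst a x) x = 0 := by rw [real_inner_comm, inner_frameFst]
  have h2 : inner ℝ (frameSnd a x) x = 0 := by rw [real_inner_comm, inner_frameSnd]
  have h3 : inner ℝ (frameSnd a x) (frameFst a x) = 0 := by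
    rw [real_inner_comm, inner_frameFst_frameSnd]
  rw [← real_inner_self_eq_norm_sq]
  simp only [inner_add_left, inner_add_right, real_inner_smul_left, real_inner_smul_right,
    real_inner_self_eq_norm_sq, inner_frameFst, inner_frameSnd, inner_frameFst_frameSnd,
    norm_smul, mul_pow, Real.norm_eq_abs, sq_abs, norm_frameFst h, norm_frameSnd h, h1, h2, h3]
  ring

lemma contDiffAt_frameFst {E : Type*} [NormedAddCommGroup E] [NormedSpace ℝ E] {f : E → E3}
    {z : E} {n : WithTop ℕ∞} (hf : ContDiffAt ℝ n f z) (h : crossE3 a (f z) ≠ 0) :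
    ContDiffAt ℝ n (fun y => frameFst a (f y)) z := by
  have hc : ContDiffAt ℝ n (fun y => crossE3 a (f y)) z := contDiffAt_const.crossE3 hf
  exact ((hc.norm ℝ h).inv (norm_ne_zero_iff.2 h)).smul hc

lemma contDiffAt_frameSnd {E : Type*} [NormedAddCommGroup E] [NormedSpace ℝ E] {f : E → E3}
    {z : E} {n : WithTop ℕ∞} (hf : ContDiffAt ℝ n f z) (h : crossE3 a (f z) ≠ 0) :
    ContDiffAt ℝ n (fun y => frameSnd a (f y)) z := by
  have hx := ne_zero_of_crossE3_ne_zero h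
  exact ((hf.norm ℝ hx).inv (norm_ne_zero_iff.2 hx)).smul (hf.crossE3 (contDiffAt_frameFst hf h))

end Frame

/-- For `(c, s)` on the unit circle, a point of the circle of radius `δ ‖x‖` on the unit sphere
centred at the direction of `x`; the argument is `(δ, (c, s), x)`. -/
def sphereLoop (a : E3) (q : ℝ × (ℝ × ℝ) × E3) : E3 :=
  (√(1 - q.1 ^ 2 * ‖q.2.2‖ ^ 2) * ‖q.2.2‖⁻¹) • q.2.2 +
    ((q.1 * ‖q.2.2‖ * q.2.1.1) • frameFst a q.2.2 + (q.1 * ‖q.2.2‖ * q.2.1.2) • frameSnd a q.2.2)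

/-- The rescaled velocity of `sphereLoop`, when `(c, s)` runs through the unit circle at a speed
large compared with that of `x`; the argument is `((δ, η), (c, s), v, x)`, where `v` is the
velocity of `x` and `η` the ratio of the two speeds. -/
def loopVelocity (a : E3) (q : (ℝ × ℝ) × (ℝ × ℝ) × E3 × E3) : E3 :=
  ((-(‖q.2.2.2‖ * q.2.1.2)) • frameFst a q.2.2.2 + (‖q.2.2.2‖ * q.2.1.1) • frameSnd a q.2.2.2) +
    q.1.2 • fderiv ℝ (sphereLoop a) (q.1.1, q.2.1, q.2.2.2) (0, 0, q.2.2.1)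

/-- The velocity of the curve whose unit tangent is `sphereLoop` and whose speed is the norm of
`loopVelocity`. -/
def curveVelocity (a : E3) (q : (ℝ × ℝ) × (ℝ × ℝ) × E3 × E3) : E3 :=
  ‖loopVelocity a q‖ • sphereLoop a (q.1.1, q.2.1, q.2.2.2)

section Loop

variable {a : E3}

lemma contDiffAt_sphereLoop {q : ℝ × (ℝ × ℝ) × E3} (h : crossE3 a q.2.2 ≠ 0)
    (hδ : q.1 ^ 2 * ‖q.2.2‖ ^ 2 < 1) {n : WithTop ℕ∞} : ContDiffAt ℝ n (sphereLoop a) q := by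
  have hx := ne_zero_of_crossE3_ne_zero h
  have h1 : ContDiffAt ℝ n (fun q : ℝ × (ℝ × ℝ) × E3 => q.2.2) q := by fun_prop
  have h2 : ContDiffAt ℝ n (fun q : ℝ × (ℝ × ℝ) × E3 => ‖q.2.2‖) q := h1.norm ℝ hx
  have h3 := h2.inv (norm_ne_zero_iff.2 hx)
  have h4 : ContDiffAt ℝ n (fun q : ℝ × (ℝ × ℝ) × E3 => √(1 - q.1 ^ 2 * ‖q.2.2‖ ^ 2)) q :=
    ContDiffAt.sqrt (by fun_prop) (by linarith)
  have h5 := contDiffAt_frameFst h1 h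
  have h6 := contDiffAt_frameSnd h1 h
  have h7 : ContDiffAt ℝ n (fun q : ℝ × (ℝ × ℝ) × E3 =>
      (q.1 * ‖q.2.2‖ * q.2.1.1) • frameFst a q.2.2 +
        (q.1 * ‖q.2.2‖ * q.2.1.2) • frameSnd a q.2.2) q := by fun_prop
  exact ((h4.mul h3).smul h1).add h7

lemma norm_sphereLoop {q : ℝ × (ℝ × ℝ) × E3} (h : crossE3 a q.2.2 ≠ 0)
    (hδ : q.1 ^ 2 * ‖q.2.2‖ ^ 2 < 1) (hc : q.2.1.1 ^ 2 + q.2.1.2 ^ 2 = 1) :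
    ‖sphereLoop a q‖ = 1 := by
  have hx := norm_ne_zero_iff.2 (ne_zero_of_crossE3_ne_zero h)
  have hsq : ‖sphereLoop a q‖ ^ 2 = 1 ^ 2 := by
    rw [sphereLoop, norm_frame_combination_sq h, mul_pow, Real.sq_sqrt (by linarith)]
    field_simp
    linear_combination q.1 ^ 2 * ‖q.2.2‖ ^ 2 * hc
  exact (sq_eq_sq₀ (norm_nonneg _) zero_le_one).1 hsq

lemma fderiv_sphereLoop_circle {δ c s α β : ℝ} {x : E3} (h : crossE3 a x ≠ 0)
    (hδ : δ ^ 2 * ‖x‖ ^ 2 < 1) :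
    fderiv ℝ (sphereLoop a) (δ, (c, s), x) (0, (α, β), 0) =
      (δ * ‖x‖ * α) • frameFst a x + (δ * ‖x‖ * β) • frameSnd a x := by
  have hd : HasFDerivAt (sphereLoop a) (fderiv ℝ (sphereLoop a) (δ, (c, s), x)) (δ, (c, s), x) :=
    ((contDiffAt_sphereLoop h hδ (n := 1)).differentiableAt one_ne_zero).hasFDerivAt
  have hline : HasDerivAt (fun t : ℝ => (δ, (c + t * α, s + t * β), x)) (0, (α, β), 0) 0 := by
    refine (hasDerivAt_const _ _).prodMk (HasDerivAt.prodMk (HasDerivAt.prodMk ?_ ?_)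
      (hasDerivAt_const _ _))
    · simpa using ((hasDerivAt_id (0 : ℝ)).mul_const α).const_add c
    · simpa using ((hasDerivAt_id (0 : ℝ)).mul_const β).const_add s
  have h1 : HasDerivAt (fun t : ℝ => sphereLoop a (δ, (c + t * α, s + t * β), x))
      (fderiv ℝ (sphereLoop a) (δ, (c, s), x) (0, (α, β), 0)) 0 :=
    HasFDerivAt.comp_hasDerivAt (l := sphereLoop a) (0 : ℝ) (by simpa using hd) hline
  have h2 : HasDerivAt (fun t : ℝ => sphereLoop a (δ, (c + t * α, s + t * β), x))
      ((δ * ‖x‖ * α) • frameFst a x + (δ * ‖x‖ * β) • frameSnd a x) 0 := by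
    have e : ∀ u v : ℝ, HasDerivAt (fun t : ℝ => δ * ‖x‖ * (u + t * v)) (δ * ‖x‖ * v) 0 :=
      fun u v => by
        simpa using (((hasDerivAt_id (0 : ℝ)).mul_const v).const_add u).const_mul (δ * ‖x‖)
    exact (((e c α).smul_const (frameFst a x)).add
      ((e s β).smul_const (frameSnd a x))).const_add ((√(1 - δ ^ 2 * ‖x‖ ^ 2) * ‖x‖⁻¹) • x)
  exact h1.unique h2

lemma contDiffAt_loopVelocity {q : (ℝ × ℝ) × (ℝ × ℝ) × E3 × E3} (h : crossE3 a q.2.2.2 ≠ 0)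
    (hδ : q.1.1 ^ 2 * ‖q.2.2.2‖ ^ 2 < 1) : ContDiffAt ℝ 1 (loopVelocity a) q := by
  have hx := ne_zero_of_crossE3_ne_zero h
  have h1 : ContDiffAt ℝ 1 (fun q : (ℝ × ℝ) × (ℝ × ℝ) × E3 × E3 => q.2.2.2) q := by fun_prop
  have h2 : ContDiffAt ℝ 1 (fun q : (ℝ × ℝ) × (ℝ × ℝ) × E3 × E3 => ‖q.2.2.2‖) q := h1.norm ℝ hx
  have h5 := contDiffAt_frameFst h1 h
  have h6 := contDiffAt_frameSnd h1 h
  have h7 : ContDiffAt ℝ 1 (fderiv ℝ (sphereLoop a)) (q.1.1, q.2.1, q.2.2.2) :=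
    (contDiffAt_sphereLoop (q := (q.1.1, q.2.1, q.2.2.2)) h hδ (n := 2)).fderiv_right
      (by norm_num)
  have h8 : ContDiffAt ℝ 1 (fun q : (ℝ × ℝ) × (ℝ × ℝ) × E3 × E3 =>
      fderiv ℝ (sphereLoop a) (q.1.1, q.2.1, q.2.2.2)) q :=
    h7.comp q (by fun_prop)
  unfold loopVelocity
  fun_prop

lemma contDiffAt_curveVelocity {q : (ℝ × ℝ) × (ℝ × ℝ) × E3 × E3} (h : crossE3 a q.2.2.2 ≠ 0)
    (hδ : q.1.1 ^ 2 * ‖q.2.2.2‖ ^ 2 < 1) (hv : loopVelocity a q ≠ 0) :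
    ContDiffAt ℝ 1 (curveVelocity a) q := by
  have h1 : ContDiffAt ℝ 1 (fun q : (ℝ × ℝ) × (ℝ × ℝ) × E3 × E3 =>
      sphereLoop a (q.1.1, q.2.1, q.2.2.2)) q :=
    ContDiffAt.comp (g := sphereLoop a) q
      (contDiffAt_sphereLoop (q := (q.1.1, q.2.1, q.2.2.2)) h hδ) (by fun_prop)
  exact ((contDiffAt_loopVelocity h hδ).norm ℝ hv).smul h1

lemma norm_loopVelocity_zero {y : (ℝ × ℝ) × E3 × E3} (h : crossE3 a y.2.2 ≠ 0)
    (hc : y.1.1 ^ 2 + y.1.2 ^ 2 = 1) : ‖loopVelocity a ((0, 0), y)‖ = ‖y.2.2‖ := by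
  have hsq : ‖loopVelocity a ((0, 0), y)‖ ^ 2 = ‖y.2.2‖ ^ 2 := by
    have := norm_frame_combination_sq h 0 (-(‖y.2.2‖ * y.1.2)) (‖y.2.2‖ * y.1.1)
    rw [zero_smul, zero_add] at this
    simp only [loopVelocity, zero_smul, add_zero]
    rw [this]
    linear_combination ‖y.2.2‖ ^ 2 * hc
  exact (sq_eq_sq₀ (norm_nonneg _) (norm_nonneg _)).1 hsq

lemma curveVelocity_zero {y : (ℝ × ℝ) × E3 × E3} (h : crossE3 a y.2.2 ≠ 0)
    (hc : y.1.1 ^ 2 + y.1.2 ^ 2 = 1) : curveVelocity a ((0, 0), y) = y.2.2 := by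
  have hx := norm_ne_zero_iff.2 (ne_zero_of_crossE3_ne_zero h)
  rw [curveVelocity, norm_loopVelocity_zero h hc]
  simp [sphereLoop, smul_smul, hx]

end Loop

/-! ### Closed spherical curves with prescribed approximate mean velocity -/

/-- A small Lipschitz perturbation of the identity vanishes somewhere in a given ball. -/
lemma exists_eq_neg_apply {T : E3 → E3} {R : ℝ} (hR : 0 ≤ R)
    (hmaps : ∀ p ∈ closedBall (0 : E3) R, ‖T p‖ ≤ R)
    (hlip : ∀ p ∈ closedBall (0 : E3) R, ∀ q ∈ closedBall (0 : E3) R,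
      ‖T p - T q‖ ≤ 1 / 2 * ‖p - q‖) :
    ∃ p ∈ closedBall (0 : E3) R, p = -T p := by
  have hm : MapsTo (fun p => -T p) (closedBall (0 : E3) R) (closedBall (0 : E3) R) := by
    intro p hp
    rw [mem_closedBall_zero_iff, norm_neg]
    exact hmaps p hp
  have hcontr : ContractingWith (1 / 2) (MapsTo.restrict (fun p => -T p) _ _ hm) := by
    refine ⟨by rw [← NNReal.coe_lt_coe]; norm_num, LipschitzWith.of_dist_le_mul ?_⟩
    rintro ⟨p, hp⟩ ⟨q, hq⟩
    have h := hlip p hp q hq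
    rw [← dist_eq_norm, ← dist_eq_norm, ← dist_neg_neg] at h
    exact h.trans_eq (by norm_num [Subtype.dist_eq])
  obtain ⟨p, hp, hfix, -⟩ := hcontr.exists_fixedPoint' isClosed_closedBall.isComplete hm
    (mem_closedBall_self hR) (edist_ne_top _ _)
  exact ⟨p, hp, hfix.symm⟩

lemma isCompact_unitCircle : IsCompact {c : ℝ × ℝ | c.1 ^ 2 + c.2 ^ 2 = 1} := by
  have hsq : IsCompact (Icc (-1 : ℝ) 1 ×ˢ Icc (-1 : ℝ) 1) := isCompact_Icc.prod isCompact_Icc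
  refine hsq.of_isClosed_subset (isClosed_eq (by fun_prop) continuous_const) fun c hc => ?_
  have hc' : c.1 ^ 2 + c.2 ^ 2 = 1 := hc
  exact ⟨abs_le.1 (abs_le_one_iff_mul_self_le_one.2 (by nlinarith [sq_nonneg c.2])),
    abs_le.1 (abs_le_one_iff_mul_self_le_one.2 (by nlinarith [sq_nonneg c.1]))⟩

lemma eventually_loopVelocity_ne_zero {a : E3} {S : Set ((ℝ × ℝ) × E3 × E3)} (hS : IsCompact S)
    (hcross : ∀ y ∈ S, crossE3 a y.2.2 ≠ 0) (hcirc : ∀ y ∈ S, y.1.1 ^ 2 + y.1.2 ^ 2 = 1) :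
    ∀ᶠ μ : ℝ × ℝ in nhds (0, 0), ∀ y ∈ S,
      μ.1 ^ 2 * ‖y.2.2‖ ^ 2 < 1 ∧ loopVelocity a (μ, y) ≠ 0 := by
  refine hS.eventually_forall_of_forall_eventually fun y hy => ?_
  have hc : Continuous (fun z : (ℝ × ℝ) × (ℝ × ℝ) × E3 × E3 => z.1.1 ^ 2 * ‖z.2.2.2‖ ^ 2) := by
    fun_prop
  have h0 : loopVelocity a ((0, 0), y) ≠ 0 := by
    rw [← norm_ne_zero_iff, norm_loopVelocity_zero (hcross y hy) (hcirc y hy), norm_ne_zero_iff]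
    exact ne_zero_of_crossE3_ne_zero (hcross y hy)
  have hcv : ContinuousAt (loopVelocity a) ((0, 0), y) :=
    (contDiffAt_loopVelocity (hcross y hy) (by simp)).continuousAt
  exact (hc.continuousAt.eventually (gt_mem_nhds (by simp))).and (hcv.eventually_ne h0)

lemma hasDerivAt_sphereLoop {a : E3} {w : ℝ → E3} (hw : ContDiff ℝ 1 w) {p : E3}
    {δ η ω s : ℝ} (hωδη : ω * δ * η = 1) (hcross : crossE3 a (w s + p) ≠ 0)
    (hδ : δ ^ 2 * ‖w s + p‖ ^ 2 < 1) :
    HasDerivAt (fun s => sphereLoop a (δ, (cos (ω * s), sin (ω * s)), w s + p))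
      ((ω * δ) • loopVelocity a ((δ, η), (cos (ω * s), sin (ω * s)), deriv w s, w s + p)) s := by
  have hd : HasFDerivAt (sphereLoop a) _ (δ, (cos (ω * s), sin (ω * s)), w s + p) :=
    ((contDiffAt_sphereLoop (q := (δ, (cos (ω * s), sin (ω * s)), w s + p))
      hcross hδ (n := 1)).differentiableAt one_ne_zero).hasFDerivAt
  have hlin : HasDerivAt (fun s : ℝ => ω * s) ω s := by
    simpa using (hasDerivAt_id s).const_mul ω
  have hw' : HasDerivAt w (deriv w s) s := (hw.differentiable one_ne_zero s).hasDerivAt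
  have hline : HasDerivAt (fun s => (δ, (cos (ω * s), sin (ω * s)), w s + p))
      (0, (-sin (ω * s) * ω, cos (ω * s) * ω), deriv w s) s :=
    (hasDerivAt_const _ _).prodMk ((hlin.cos.prodMk hlin.sin).prodMk (hw'.add_const p))
  have h := HasFDerivAt.comp_hasDerivAt (l := sphereLoop a) s hd hline
  refine h.congr_deriv ?_
  have hsplit : ((0, (-sin (ω * s) * ω, cos (ω * s) * ω), deriv w s) : ℝ × (ℝ × ℝ) × E3) =
      (0, (-sin (ω * s) * ω, cos (ω * s) * ω), 0) + (0, 0, deriv w s) := by simp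
  rw [hsplit, map_add, fderiv_sphereLoop_circle hcross hδ, loopVelocity, smul_add, smul_smul,
    hωδη, one_smul, smul_add, smul_smul, smul_smul]
  congr 3 <;> ring_nf

/-- A mean-zero nowhere vanishing velocity field `w` is approximated by the velocity of a closed
curve whose unit tangent `τ` winds many times around small loops on the sphere. -/
lemma eventually_exists_closed_indicatrix {w : ℝ → E3} (hw : ContDiff ℝ 1 w)
    (hper : ∀ s, w (s + 1) = w s) (hmean : (∫ s in (0 : ℝ)..1, w s) = 0) (hne : ∀ s, w s ≠ 0)
    {ε : ℝ} (hε : 0 < ε) :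
    ∀ᶠ μ : ℝ × ℝ in nhds (0, 0), ∀ N : ℕ, 0 < μ.1 → 0 < μ.2 → 2 * π * N * μ.1 * μ.2 = 1 →
      ∃ τ : ℝ → E3, ContDiff ℝ 1 τ ∧ (∀ s, τ (s + 1) = τ s) ∧ (∀ s, ‖τ s‖ = 1) ∧
        (∀ s, deriv τ s ≠ 0) ∧ (∫ s in (0 : ℝ)..1, ‖deriv τ s‖ • τ s) = 0 ∧
        ∀ s, ‖(μ.2 * ‖deriv τ s‖) • τ s - w s‖ ≤ ε := by
  obtain ⟨a, ha⟩ := exists_transverse_direction hw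
  have hcrossC : Continuous (crossE3 a) :=
    (contDiff_iff_contDiffAt.2 fun x =>
      contDiffAt_const.crossE3 contDiffAt_id : ContDiff ℝ 1 (crossE3 a)).continuous
  have hopen : IsOpen {x | crossE3 a x ≠ 0} := isOpen_ne_fun hcrossC continuous_const
  have hcw : IsCompact (w '' Icc 0 1) := isCompact_Icc.image hw.continuous
  obtain ⟨R₀, hR₀, hsub₀⟩ := hcw.exists_cthickening_subset_open hopen (by
    rintro _ ⟨s, -, rfl⟩ h0
    obtain ⟨c, hc⟩ := exists_smul_eq_of_crossE3_eq_zero (hne s) h0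
    exact ha s c hc)
  obtain ⟨R, hR, hRR₀, hRε⟩ : ∃ R, 0 < R ∧ R ≤ R₀ ∧ R ≤ ε / 2 :=
    ⟨min R₀ (ε / 2), lt_min hR₀ (half_pos hε), min_le_left _ _, min_le_right _ _⟩
  have hsub := (cthickening_mono hRR₀ (w '' Icc 0 1)).trans hsub₀
  set K := cthickening R (w '' Icc 0 1)
  have hK : IsCompact K := hcw.cthickening
  have hdw : Continuous (deriv w) := hw.continuous_deriv le_rfl
  set S : Set ((ℝ × ℝ) × E3 × E3) :=
    {c : ℝ × ℝ | c.1 ^ 2 + c.2 ^ 2 = 1} ×ˢ ((deriv w '' Icc 0 1) ×ˢ K)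
  have hS : IsCompact S := isCompact_unitCircle.prod ((isCompact_Icc.image hdw).prod hK)
  have hcross : ∀ y ∈ S, crossE3 a y.2.2 ≠ 0 := fun y hy => hsub hy.2.2
  have hcirc : ∀ y ∈ S, y.1.1 ^ 2 + y.1.2 ^ 2 = 1 := fun y hy => hy.1
  have hsmooth : ∀ y ∈ S, ContDiffAt ℝ 1 (curveVelocity a) ((0, 0), y) := by
    intro y hy
    refine contDiffAt_curveVelocity (hcross y hy) (by simp) ?_
    rw [← norm_ne_zero_iff, norm_loopVelocity_zero (hcross y hy) (hcirc y hy), norm_ne_zero_iff]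
    exact ne_zero_of_crossE3_ne_zero (hcross y hy)
  filter_upwards [eventually_loopVelocity_ne_zero hS hcross hcirc,
    eventually_small_lipschitz_difference hS hsmooth (lt_min hR (one_half_pos (α := ℝ)))]
    with ⟨δ, η⟩ hgood hsmall N hδ hη hN
  simp only at hδ hη hN ⊢
  set ω : ℝ := 2 * π * N
  have hω : 0 < ω := by
    have : 0 ≤ ω := by positivity
    refine this.lt_of_ne fun h => ?_
    rw [← h] at hN
    simp at hN
  -- the arguments at which the loop functions are evaluated
  let Y : E3 → ℝ → (ℝ × ℝ) × E3 × E3 := fun p s => ((cos (ω * s), sin (ω * s)), deriv w s, w s + p)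
  have htrig : ∀ s, cos (ω * (s + 1)) = cos (ω * s) ∧ sin (ω * (s + 1)) = sin (ω * s) := by
    intro s
    have : ω * (s + 1) = ω * s + N * (2 * π) := by simp only [ω]; ring
    rw [this]
    exact ⟨cos_add_nat_mul_two_pi _ _, sin_add_nat_mul_two_pi _ _⟩
  have hYper : ∀ p, Function.Periodic (Y p) 1 := by
    intro p s
    have e : deriv w (s + 1) = deriv w s := periodic_deriv hper s
    simp only [Y, (htrig s).1, (htrig s).2, hper, e]
  have hYS : ∀ p ∈ closedBall (0 : E3) R, ∀ s, Y p s ∈ S := by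
    intro p hp s
    rw [← periodic_apply_fract (hYper p) s]
    have hs : Int.fract s ∈ Icc (0 : ℝ) 1 := ⟨Int.fract_nonneg _, (Int.fract_lt_one _).le⟩
    refine ⟨cos_sq_add_sin_sq _, mem_image_of_mem _ hs, ?_⟩
    refine mem_cthickening_of_dist_le _ _ _ _ (mem_image_of_mem w hs) ?_
    rw [dist_eq_norm, add_sub_cancel_left]
    exact mem_closedBall_zero_iff.1 hp
  have hYc : ∀ p, Continuous (Y p) := by
    intro p
    have := hw.continuous
    simp only [Y]
    fun_prop
  have hfc : ∀ p ∈ closedBall (0 : E3) R,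
      Continuous (fun s => curveVelocity a ((δ, η), Y p s)) := by
    intro p hp
    refine continuous_iff_continuousAt.2 fun s => ?_
    have hy := hYS p hp s
    have h1 : ContinuousAt (curveVelocity a) ((δ, η), Y p s) :=
      (contDiffAt_curveVelocity (hcross _ hy) (hgood _ hy).1 (hgood _ hy).2).continuousAt
    exact ContinuousAt.comp (g := curveVelocity a) h1 (by have := hYc p; fun_prop)
  have hbase : ∀ p ∈ closedBall (0 : E3) R, ∀ s,
      curveVelocity a ((0, 0), Y p s) = w s + p :=
    fun p hp s => curveVelocity_zero (hcross _ (hYS p hp s)) (hcirc _ (hYS p hp s))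
  let e : E3 → ℝ → E3 := fun p s => curveVelocity a ((δ, η), Y p s) - (w s + p)
  have hec : ∀ p ∈ closedBall (0 : E3) R, Continuous (e p) := fun p hp => by
    have h1 := hfc p hp
    have h2 := hw.continuous
    simp only [e]
    fun_prop
  have he1 : ∀ p ∈ closedBall (0 : E3) R, ∀ s, ‖e p s‖ ≤ R := fun p hp s => by
    have := (hsmall _ (hYS p hp s)).1
    rw [hbase p hp] at this
    exact this.trans (min_le_left _ _)
  have he2 : ∀ p ∈ closedBall (0 : E3) R, ∀ q ∈ closedBall (0 : E3) R, ∀ s,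
      ‖e p s - e q s‖ ≤ 1 / 2 * ‖p - q‖ := fun p hp q hq s => by
    have := (hsmall _ (hYS p hp s)).2 _ (hYS q hq s)
    rw [hbase p hp, hbase q hq] at this
    refine this.trans ?_
    have hn : ‖Y p s - Y q s‖ = ‖p - q‖ := by
      simp [Y, Prod.norm_def]
    rw [hn]
    gcongr
    exact min_le_right _ _
  obtain ⟨p, hp, hfix⟩ := exists_eq_neg_apply (T := fun p => ∫ s in (0 : ℝ)..1, e p s) hR.le
    (fun p hp => by
      simpa using intervalIntegral.norm_integral_le_of_norm_le_const
        (a := 0) (b := 1) (fun s _ => he1 p hp s))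
    (fun p hp q hq => by
      rw [← intervalIntegral.integral_sub ((hec p hp).intervalIntegrable _ _)
        ((hec q hq).intervalIntegrable _ _)]
      simpa using intervalIntegral.norm_integral_le_of_norm_le_const
        (a := 0) (b := 1) (fun s _ => he2 p hp q hq s))
  have hclose : (∫ s in (0 : ℝ)..1, curveVelocity a ((δ, η), Y p s)) = 0 := by
    have h1 : (∫ s in (0 : ℝ)..1, e p s) =
        (∫ s in (0 : ℝ)..1, curveVelocity a ((δ, η), Y p s)) - p := by
      have hwp : Continuous fun s => w s + p := by
        have := hw.continuous
        fun_prop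
      simp only [e]
      rw [intervalIntegral.integral_sub ((hfc p hp).intervalIntegrable _ _)
        (hwp.intervalIntegrable _ _), intervalIntegral.integral_add
        (hw.continuous.intervalIntegrable _ _) (continuous_const.intervalIntegrable _ _), hmean]
      simp
    rw [h1, neg_sub] at hfix
    exact (sub_eq_self.1 hfix.symm)
  have hderiv : ∀ s, HasDerivAt (fun s => sphereLoop a (δ, (cos (ω * s), sin (ω * s)), w s + p))
      ((ω * δ) • loopVelocity a ((δ, η), Y p s)) s := fun s =>
    hasDerivAt_sphereLoop hw hN (hcross _ (hYS p hp s)) (hgood _ (hYS p hp s)).1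
  have hspeed : ∀ s, ‖(ω * δ) • loopVelocity a ((δ, η), Y p s)‖ =
      ω * δ * ‖loopVelocity a ((δ, η), Y p s)‖ := fun s => by
    rw [norm_smul, Real.norm_of_nonneg (by positivity)]
  refine ⟨fun s => sphereLoop a (δ, (cos (ω * s), sin (ω * s)), w s + p), ?_, ?_, ?_, ?_, ?_, ?_⟩
  · refine contDiff_iff_contDiffAt.2 fun s => ?_
    have h1 : ContDiffAt ℝ 1 (sphereLoop a) (δ, (cos (ω * s), sin (ω * s)), w s + p) :=
      contDiffAt_sphereLoop (hcross _ (hYS p hp s)) (hgood _ (hYS p hp s)).1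
    exact ContDiffAt.comp (g := sphereLoop a) s h1 (by fun_prop)
  · intro s
    simp only [(htrig s).1, (htrig s).2, hper]
  · exact fun s => norm_sphereLoop (hcross _ (hYS p hp s)) (hgood _ (hYS p hp s)).1
      (hcirc _ (hYS p hp s))
  · intro s
    rw [(hderiv s).deriv]
    exact smul_ne_zero (by positivity) (hgood _ (hYS p hp s)).2
  · have h1 : ∀ s, ‖deriv (fun s => sphereLoop a (δ, (cos (ω * s), sin (ω * s)), w s + p)) s‖ •
        sphereLoop a (δ, (cos (ω * s), sin (ω * s)), w s + p) =
        (ω * δ) • curveVelocity a ((δ, η), Y p s) := fun s => by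
      rw [(hderiv s).deriv, hspeed, curveVelocity, smul_smul]
    simp only [h1]
    rw [intervalIntegral.integral_smul, hclose, smul_zero]
  · intro s
    have h1 : (η * ‖deriv (fun s => sphereLoop a (δ, (cos (ω * s), sin (ω * s)), w s + p)) s‖) •
        sphereLoop a (δ, (cos (ω * s), sin (ω * s)), w s + p) =
        curveVelocity a ((δ, η), Y p s) := by
      rw [(hderiv s).deriv, hspeed, curveVelocity, ← mul_assoc, mul_comm η, hN, one_mul]
    rw [h1]
    calc _ = ‖e p s + p‖ := by simp only [e]; congr 1; abel
      _ ≤ R + R := (norm_add_le _ _).trans (add_le_add (he1 p hp s) (mem_closedBall_zero_iff.1 hp))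
      _ ≤ ε := by linarith

/-! ### Curves of constant curvature from spherical curves -/

/-- A regular closed curve `τ` of class `C¹` on the unit sphere whose arclength-weighted mean
vanishes is the tangent indicatrix of a closed curve of constant curvature one. -/
lemma exists_unit_curvature_curve {τ ρ : ℝ → E3} (hτ : ContDiff ℝ 1 τ)
    (hτper : ∀ s, τ (s + 1) = τ s) (hτ1 : ∀ s, ‖τ s‖ = 1) (hτ' : ∀ s, deriv τ s ≠ 0)
    (hρ : ∀ s, HasDerivAt ρ (‖deriv τ s‖ • τ s) s) (hρper : ∀ s, ρ (s + 1) = ρ s)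
    (hρinj : InjOn ρ (Ico 0 1)) :
    ∃ (L : ℝ) (r : ℝ → E3), 0 < L ∧ ContDiff ℝ 2 r ∧ (∀ s, r (s + L) = r s) ∧
      (∀ s, ‖deriv r s‖ = 1) ∧ (∀ s, ‖deriv (deriv r) s‖ = 1) ∧ InjOn r (Ico 0 L) ∧
      range r = range ρ := by
  have hdτ : Continuous (deriv τ) := hτ.continuous_deriv le_rfl
  let v : ℝ → ℝ := fun s => ‖deriv τ s‖
  have hv : Continuous v := hdτ.norm
  have hv0 : ∀ s, 0 < v s := fun s => norm_pos_iff.2 (hτ' s)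
  have hvper : Function.Periodic v 1 := fun s => by
    have e : deriv τ (s + 1) = deriv τ s := periodic_deriv hτper s
    simp only [v, e]
  let φ : ℝ → ℝ := fun s => ∫ u in (0 : ℝ)..s, v u
  have hφ : ∀ s, HasDerivAt φ (v s) s := fun s =>
    intervalIntegral.integral_hasDerivAt_right (hv.intervalIntegrable _ _)
      (hv.stronglyMeasurableAtFilter _ _) hv.continuousAt
  have hφ0 : φ 0 = 0 := intervalIntegral.integral_same
  have hφC : ContDiff ℝ 1 φ := by
    refine contDiff_one_iff_deriv.2 ⟨fun s => (hφ s).differentiableAt, ?_⟩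
    have : deriv φ = v := funext fun s => (hφ s).deriv
    rw [this]
    exact hv
  have hφmono : StrictMono φ := strictMono_of_deriv_pos fun s => by
    rw [(hφ s).deriv]
    exact hv0 s
  have hφadd : ∀ s, φ (s + 1) = φ s + φ 1 := fun s => by
    have h1 := hvper.intervalIntegral_add_eq s 0
    rw [zero_add] at h1
    simp only [φ]
    rw [← h1, intervalIntegral.integral_add_adjacent_intervals] <;>
      exact hv.intervalIntegrable _ _
  have hL : 0 < φ 1 := by
    rw [← hφ0]
    exact hφmono zero_lt_one
  have hφint : ∀ n : ℕ, φ n = n * φ 1 ∧ φ (-n) = -(n * φ 1) := by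
    intro n
    induction n with
    | zero => simp [hφ0]
    | succ k ih =>
      have h1 := hφadd k
      have h2 := hφadd (-((k + 1 : ℕ) : ℝ))
      have e : -((k + 1 : ℕ) : ℝ) + 1 = -k := by push_cast; ring
      rw [e] at h2
      push_cast at h2 ⊢
      exact ⟨by rw [h1, ih.1]; ring, by linarith [ih.2]⟩
  have hφsurj : Function.Surjective φ := by
    intro y
    obtain ⟨n, hn⟩ := exists_nat_gt (|y| / φ 1)
    rw [div_lt_iff₀ hL] at hn
    have hy := abs_le.1 hn.le
    have hmem : y ∈ Icc (φ (-n)) (φ n) := by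
      rw [(hφint n).1, (hφint n).2]
      exact hy
    obtain ⟨s, -, hs⟩ := intermediate_value_Icc
      (by linarith [n.cast_nonneg (α := ℝ)]) hφC.continuous.continuousOn hmem
    exact ⟨s, hs⟩
  let Φ : ℝ ≃ₜ ℝ := (hφmono.orderIsoOfSurjective φ hφsurj).toHomeomorph
  let ψ : ℝ → ℝ := Φ.symm
  have hφψ : ∀ t, φ (ψ t) = t := fun t => Φ.apply_symm_apply t
  have hψφ : ∀ s, ψ (φ s) = s := fun s => Φ.symm_apply_apply s
  have hψC : ContDiff ℝ 1 ψ :=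
    Φ.contDiff_symm_deriv (f' := v) (fun s => (hv0 s).ne') hφ hφC
  have hψ : ∀ t, HasDerivAt ψ (v (ψ t))⁻¹ t := fun t =>
    HasDerivAt.of_local_left_inverse hψC.continuous.continuousAt (hφ (ψ t)) (hv0 _).ne'
      (Filter.Eventually.of_forall hφψ)
  have hr : ∀ t, HasDerivAt (fun t => ρ (ψ t)) (τ (ψ t)) t := fun t => by
    have := HasDerivAt.scomp t (hρ (ψ t)) (hψ t)
    rwa [smul_smul, inv_mul_cancel₀ (hv0 _).ne', one_smul] at this
  have hr' : deriv (fun t => ρ (ψ t)) = fun t => τ (ψ t) := funext fun t => (hr t).deriv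
  have hψadd : ∀ t, ψ (t + φ 1) = ψ t + 1 := fun t => by
    apply hφmono.injective
    rw [hφψ, hφadd, hφψ]
  refine ⟨φ 1, fun t => ρ (ψ t), hL, ?_, fun t => ?_, fun t => ?_, fun t => ?_, ?_, ?_⟩
  · rw [show (2 : WithTop ℕ∞) = 1 + 1 by norm_num, contDiff_succ_iff_deriv]
    refine ⟨fun t => (hr t).differentiableAt, by simp, ?_⟩
    rw [hr']
    exact hτ.comp hψC
  · simp only [hψadd, hρper]
  · rw [hr', hτ1]
  · rw [hr']
    have h1 : HasDerivAt τ (deriv τ (ψ t)) (ψ t) :=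
      (hτ.differentiable one_ne_zero _).hasDerivAt
    have h2 := HasDerivAt.scomp t h1 (hψ t)
    have h3 : deriv (fun t => τ (ψ t)) t = (v (ψ t))⁻¹ • deriv τ (ψ t) := h2.deriv
    rw [h3, norm_smul, norm_inv, Real.norm_of_nonneg (hv0 _).le, inv_mul_cancel₀ (hv0 _).ne']
  · have hmem : ∀ t ∈ Ico 0 (φ 1), ψ t ∈ Ico (0 : ℝ) 1 := fun t ht =>
      ⟨hφmono.le_iff_le.1 (by rw [hφ0, hφψ]; exact ht.1),
        hφmono.lt_iff_lt.1 (by rw [hφψ]; exact ht.2)⟩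
    intro t ht u hu h
    have := hρinj (hmem t ht) (hmem u hu) h
    rw [← hφψ t, this, hφψ]
  · ext x
    constructor
    · rintro ⟨t, rfl⟩
      exact ⟨ψ t, rfl⟩
    · rintro ⟨s, rfl⟩
      exact ⟨φ s, by simp only [hψφ]⟩

/-- Every regular closed curve of class `C¹` is approximated in the `C¹` sense by the primitives
of the closed spherical curves with large frequency. -/
lemma eventually_exists_indicatrix_near {γ : ℝ → E3} (hper : ∀ s, γ (s + 1) = γ s)
    (hC : ContDiff ℝ 1 γ) (hreg : ∀ s, deriv γ s ≠ 0) {ε : ℝ} (hε : 0 < ε) :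
    ∀ᶠ μ : ℝ × ℝ in nhds (0, 0), ∀ N : ℕ, 0 < μ.1 → 0 < μ.2 → 2 * π * N * μ.1 * μ.2 = 1 →
      ∃ τ : ℝ → E3, ContDiff ℝ 1 τ ∧ (∀ s, τ (s + 1) = τ s) ∧ (∀ s, ‖τ s‖ = 1) ∧
        (∀ s, deriv τ s ≠ 0) ∧ (∫ s in (0 : ℝ)..1, ‖deriv τ s‖ • τ s) = 0 ∧
        ∀ s, ‖(μ.2 * ‖deriv τ s‖) • τ s - deriv γ s‖ ≤ ε := by
  have hdγ : Continuous (deriv γ) := hC.continuous_deriv le_rfl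
  obtain ⟨s₀, -, hs₀⟩ := isCompact_Icc.exists_isMinOn (nonempty_Icc.2 zero_le_one)
    (hdγ.norm.continuousOn (s := Icc (0 : ℝ) 1))
  have hmin : ∀ s, ‖deriv γ s₀‖ ≤ ‖deriv γ s‖ := fun s => by
    rw [← periodic_apply_fract (periodic_deriv hper) s]
    exact hs₀ (a := Int.fract s) ⟨Int.fract_nonneg _, (Int.fract_lt_one _).le⟩
  have hpos : 0 < ‖deriv γ s₀‖ := norm_pos_iff.2 (hreg s₀)
  obtain ⟨w, hw, hwper, hwmean, hwnear⟩ := exists_contDiff_velocity_approximation hper hC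
    (lt_min (half_pos hε) (half_pos hpos))
  have hw0 : ∀ s, w s ≠ 0 := fun s h => by
    have h1 := (hwnear s).trans (min_le_right _ _)
    rw [h, zero_sub, norm_neg] at h1
    linarith [hmin s]
  filter_upwards [eventually_exists_closed_indicatrix hw hwper hwmean hw0 (half_pos hε)]
    with μ hμ N h1 h2 h3
  obtain ⟨τ, a1, a2, a3, a4, a5, a6⟩ := hμ N h1 h2 h3
  refine ⟨τ, a1, a2, a3, a4, a5, fun s => ?_⟩
  calc _ ≤ ‖(μ.2 * ‖deriv τ s‖) • τ s - w s‖ + ‖w s - deriv γ s‖ :=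
        norm_sub_le_norm_sub_add_norm_sub _ _ _
    _ ≤ ε / 2 + ε / 2 := add_le_add (a6 s) ((hwnear s).trans (min_le_left _ _))
    _ = ε := add_halves ε

/-- A closed curve starting at the origin with velocity at most `ε` is bounded by `ε` and
Lipschitz with constant `ε`. -/
lemma smallDisplacement_of_norm_deriv_le {m : ℕ} {D D' : Fin m → ℝ → E3} {ε : ℝ}
    (hper : ∀ i s, D i (s + 1) = D i s) (h0 : ∀ i, D i 0 = 0)
    (hD : ∀ i s, HasDerivAt (D i) (D' i s) s) (hle : ∀ i s, ‖D' i s‖ ≤ ε) :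
    SmallDisplacement D ε := by
  have hlip : ∀ i s t, ‖D i s - D i t‖ ≤ ε * |s - t| := fun i s t =>
    convex_univ.norm_image_sub_le_of_norm_hasDerivWithin_le
      (fun u _ => (hD i u).hasDerivWithinAt) (fun u _ => hle i u) (mem_univ t) (mem_univ s)
  refine ⟨hper, fun i s => ?_, hlip⟩
  have hε : 0 ≤ ε := (norm_nonneg _).trans (hle i 0)
  have hf := hlip i (Int.fract s) 0
  rw [h0, sub_zero, sub_zero, periodic_apply_fract (hper i),
    abs_of_nonneg (Int.fract_nonneg s)] at hf
  exact hf.trans (mul_le_of_le_one_right hε (Int.fract_lt_one s).le)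

/-- A closed curve with the given continuous mean-zero velocity through a given point. -/
lemma exists_periodic_primitive {g : ℝ → E3} (hg : Continuous g) (hper : ∀ s, g (s + 1) = g s)
    (hmean : (∫ s in (0 : ℝ)..1, g s) = 0) (x : E3) :
    ∃ ρ : ℝ → E3, ρ 0 = x ∧ (∀ s, HasDerivAt ρ (g s) s) ∧ ∀ s, ρ (s + 1) = ρ s := by
  refine ⟨fun s => x + ∫ u in (0 : ℝ)..s, g u, by simp, fun s => ?_, fun s => ?_⟩
  · exact (intervalIntegral.integral_hasDerivAt_right (hg.intervalIntegrable _ _)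
      (hg.stronglyMeasurableAtFilter _ _) hg.continuousAt).const_add x
  · have h1 := Function.Periodic.intervalIntegral_add_eq hper s 0
    rw [zero_add, hmean] at h1
    simp only
    rw [← intervalIntegral.integral_add_adjacent_intervals (hg.intervalIntegrable 0 s)
      (hg.intervalIntegrable s (s + 1)), h1, add_zero]

/-- every link can be represented by C² curves of constant curvature.
A link is encoded as a finite family of C¹ embeddings `γᵢ : 𝕊¹ → ℝ³` with
nowhere-vanishing derivatives (i.e. `1`-periodic C¹ maps `ℝ → ℝ³`, injective on `[0,1)`,
with `γᵢ' ≠ 0` everywhere) whose images are pairwise disjoint.  The conclusion produces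
`Lᵢ`-periodic C² maps `rᵢ : ℝ → ℝ³` with `‖rᵢ'‖ = ‖rᵢ''‖ = 1` everywhere, each injective
on `[0, Lᵢ)`, with pairwise disjoint images, together with an ambient isotopy
`H : ℝ³ × [0, 1] → ℝ³` (continuous, `H(·,0) = id`, each `H(·,t)` a homeomorphism)
carrying the image of each `γᵢ` onto the image of `rᵢ`. -/
theorem link_has_constant_curvature_representative (m : ℕ) (γ : Fin m → ℝ → E3)
    (hper : ∀ i, ∀ s, γ i (s + 1) = γ i s)
    (hC : ∀ i, ContDiff ℝ 1 (γ i))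
    (hreg : ∀ i, ∀ s, deriv (γ i) s ≠ 0)
    (hinj : ∀ i, InjOn (γ i) (Ico 0 1))
    (hdisj : ∀ i j, i ≠ j → Disjoint (range (γ i)) (range (γ j))) :
    ∃ (L : Fin m → ℝ) (r : Fin m → ℝ → E3) (H : E3 × ℝ → E3),
      (∀ i, 0 < L i) ∧
      (∀ i, ContDiff ℝ 2 (r i)) ∧
      (∀ i, ∀ s, r i (s + L i) = r i s) ∧
      (∀ i, ∀ s, ‖deriv (r i) s‖ = 1) ∧
      (∀ i, ∀ s, ‖deriv (deriv (r i)) s‖ = 1) ∧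
      (∀ i, InjOn (r i) (Ico 0 (L i))) ∧
      (∀ i j, i ≠ j → Disjoint (range (r i)) (range (r j))) ∧
      ContinuousOn H (univ ×ˢ Icc (0 : ℝ) 1) ∧
      (∀ x : E3, H (x, 0) = x) ∧
      (∀ t ∈ Icc (0 : ℝ) 1, ∃ e : E3 ≃ₜ E3, ∀ x : E3, H (x, t) = e x) ∧
      (∀ i, (fun x => H (x, 1)) '' range (γ i) = range (r i)) := by
  obtain ⟨κ, hκ, hiso⟩ := exists_isotopy_of_small_displacement
  obtain ⟨C, hC0, hdispl⟩ := exists_displacement_le hper hC hreg hinj hdisj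
  obtain ⟨ε, hε, hεκ⟩ : ∃ ε, 0 < ε ∧ C * ε ≤ κ :=
    ⟨κ / (C + 1), by positivity, by
      rw [mul_div_assoc', div_le_iff₀ (by positivity)]
      nlinarith⟩
  have hev := Filter.eventually_all.2
    fun i => eventually_exists_indicatrix_near (hper i) (hC i) (hreg i) hε
  obtain ⟨R, hR, hball⟩ := Metric.eventually_nhds_iff.1 hev
  obtain ⟨N, hN⟩ := exists_nat_gt (1 / (2 * π * (R / 2) * R))
  have hN0 : (0 : ℝ) < N := lt_trans (by positivity) hN
  have hKpos : 0 < 2 * π * N * (R / 2) := by positivity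
  -- the curvature of the approximating curves
  set K : ℝ := 2 * π * N * (R / 2) with hK
  have hdist : dist ((R / 2, K⁻¹) : ℝ × ℝ) (0, 0) < R := by
    rw [Prod.dist_eq, Real.dist_eq, Real.dist_eq, sub_zero, sub_zero, abs_of_pos (half_pos hR),
      abs_of_pos (inv_pos.2 hKpos)]
    refine max_lt (half_lt_self hR) ?_
    rw [div_lt_iff₀ (by positivity)] at hN
    rw [inv_lt_iff_one_lt_mul₀ hKpos, hK]
    linarith
  have hτ := fun i => hball hdist i N (half_pos hR) (inv_pos.2 hKpos)
    (by rw [← hK, mul_inv_cancel₀ hKpos.ne'])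
  choose τ hτC hτper hτ1 hτ' hτmean hτnear using hτ
  have hgc : ∀ i, Continuous (fun s => ‖deriv (τ i) s‖ • τ i s) := fun i =>
    ((hτC i).continuous_deriv le_rfl).norm.smul (hτC i).continuous
  choose ρ hρ0 hρ hρper using fun i => exists_periodic_primitive (hgc i)
    (fun s => by
      have e : deriv (τ i) (s + 1) = deriv (τ i) s := periodic_deriv (hτper i) s
      simp only [e, hτper]) (hτmean i) (K • γ i 0)
  have hsmall : SmallDisplacement (fun i s => K⁻¹ • ρ i s - γ i s) ε := by
    refine smallDisplacement_of_norm_deriv_le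
      (D' := fun i s => (K⁻¹ * ‖deriv (τ i) s‖) • τ i s - deriv (γ i) s)
      (fun i s => by simp only [hρper, hper])
      (fun i => by rw [hρ0, inv_smul_smul₀ hKpos.ne', sub_self]) (fun i s => ?_) hτnear
    rw [mul_smul]
    exact ((hρ i s).const_smul K⁻¹).sub ((hC i).differentiable one_ne_zero s).hasDerivAt
  obtain ⟨G, hGc, hG0, hGt, hG1⟩ := hiso (ι := Fin m × ℝ) (fun z => γ z.1 z.2)
    (fun z => K⁻¹ • ρ z.1 z.2) fun z z' =>
      (hdispl _ _ hsmall z.1 z'.1 z.2 z'.2).trans (by gcongr)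
  have hscale : ∀ t ∈ Icc (0 : ℝ) 1, 1 + t * (K - 1) ≠ 0 := fun t ht => by
    have : 0 < (1 - t) + t * K := by
      rcases ht.1.eq_or_lt with h | h
      · rw [← h]
        norm_num
      · have := mul_pos h hKpos
        linarith [ht.2]
    linarith
  let H : E3 × ℝ → E3 := fun q => (1 + q.2 * (K - 1)) • G q
  have hHt : ∀ t ∈ Icc (0 : ℝ) 1, ∃ e : E3 ≃ₜ E3, ∀ x : E3, H (x, t) = e x := fun t ht => by
    obtain ⟨e, he⟩ := hGt t ht
    exact ⟨e.trans (Homeomorph.smulOfNeZero _ (hscale t ht)), fun x => by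
      simp only [H, he]
      rfl⟩
  have hH1 : ∀ i s, H (γ i s, 1) = ρ i s := fun i s => by
    have := hG1 (i, s)
    simp only at this
    simp only [H, this, one_mul, add_sub_cancel, smul_inv_smul₀ hKpos.ne']
  have hHinj : Function.Injective fun x => H (x, 1) := by
    obtain ⟨e, he⟩ := hHt 1 (right_mem_Icc.2 zero_le_one)
    simp only [he]
    exact e.injective
  have hρinj : ∀ i, InjOn (ρ i) (Ico 0 1) := fun i s hs t ht h =>
    hinj i hs ht (hHinj (by simp only [hH1, h]))
  choose L r hL hr2 hrper hr' hr'' hrinj hrange using fun i =>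
    exists_unit_curvature_curve (hτC i) (hτper i) (hτ1 i) (hτ' i) (hρ i) (hρper i) (hρinj i)
  have himage : ∀ i, (fun x => H (x, 1)) '' range (γ i) = range (r i) := fun i => by
    rw [hrange, ← range_comp]
    exact congrArg range (funext (hH1 i))
  refine ⟨L, r, H, hL, hr2, hrper, hr', hr'', hrinj, fun i j hij => ?_, ?_, fun x => ?_, hHt,
    himage⟩
  · rw [← himage, ← himage]
    exact (disjoint_image_iff hHinj).2 (hdisj i j hij)
  · exact Continuous.continuousOn (by fun_prop)
  · simp [H, hG0]
end
end
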